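/- arXiv:2112.08568 — 4 statements merged into one kernel-verified Lean document; each statement's English description precedes it below -/
import Mathlib

section
/- Second Barnes Lemma: Let a, b, c, d, e ∈ ℂ and set f := a + b + c + d + e. Let σ ∈ ℝ satisfy max(−Re a, −Re b, −Re c) < σ < min(Re d, Re e). Then (1/(2π)) ∫_ℝ Γ(σ+it+a) Γ(σ+it+b) Γ(σ+it+c) Γ(d−σ−it) Γ(e−σ−it) / Γ(σ+it+f) dt = Γ(d+a) Γ(d+b) Γ(d+c) Γ(e+a) Γ(e+b) Γ(e+c) / (Γ(f−a) Γ(f−b) Γ(f−c)). -/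
open Complex MeasureTheory

open Set

theorem Complex.norm_Gamma_le_Gamma_re {s : ℂ} (hs : 0 < s.re) :
    ‖Complex.Gamma s‖ ≤ Real.Gamma s.re := by
  rw [Complex.Gamma_eq_integral hs, Complex.GammaIntegral, Real.Gamma_eq_integral hs]
  refine (norm_integral_le_integral_norm _).trans_eq ?_
  refine setIntegral_congr_fun measurableSet_Ioi fun x hx => ?_
  simp only [norm_mul, norm_real, norm_cpow_eq_rpow_re_of_pos hx, sub_re, one_re,
    Real.norm_of_nonneg (Real.exp_pos _).le]

theorem integrable_inv_normSq_add_mul_I {a : ℂ} (ha : 0 < a.re) :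
    Integrable fun t : ℝ => (‖a + t * I‖ ^ 2)⁻¹ := by
  have h : Integrable fun s : ℝ => (a.re ^ 2 + s ^ 2)⁻¹ := by
    refine (integrable_inv_one_add_sq.const_mul (1 + (a.re ^ 2)⁻¹)).mono' ?_ (.of_forall fun s => ?_)
    · exact Measurable.aestronglyMeasurable (by fun_prop)
    · have : 0 < a.re ^ 2 := by positivity
      rw [Real.norm_of_nonneg (by positivity), inv_eq_one_div, ← div_eq_mul_inv,
        div_le_div_iff₀ (by positivity) (by positivity)]
      have : (1 + (a.re ^ 2)⁻¹) * (a.re ^ 2 + s ^ 2) =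
          1 * (1 + s ^ 2) + (a.re ^ 2 + (a.re ^ 2)⁻¹ * s ^ 2) := by field_simp; ring
      rw [this]
      exact le_add_of_nonneg_right (by positivity)
  refine (h.comp_add_left a.im).congr (.of_forall fun t => ?_)
  simp only [← normSq_eq_norm_sq, normSq_apply]
  simp [sq]

theorem continuous_Gamma_add_mul_I {a : ℂ} (ha : 0 < a.re) :
    Continuous fun t : ℝ => Complex.Gamma (a + t * I) := by
  refine continuous_iff_continuousAt.2 fun t => ?_
  have h : ContinuousAt Complex.Gamma (a + t * I) := by
    refine (differentiableAt_Gamma _ fun m hm => ?_).continuousAt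
    have := congrArg re hm
    simp at this
    have : (0 : ℝ) ≤ m := m.cast_nonneg
    linarith
  exact ContinuousAt.comp (f := fun t : ℝ => a + t * I) h (by fun_prop)

theorem continuous_Gamma_sub_mul_I {d : ℂ} (hd : 0 < d.re) :
    Continuous fun t : ℝ => Complex.Gamma (d - t * I) := by
  refine ((continuous_Gamma_add_mul_I hd).comp continuous_neg).congr fun t => ?_
  simp [sub_eq_add_neg]

theorem integrable_Gamma_mul_Gamma {a d : ℂ} (ha : 0 < a.re) (hd : 0 < d.re) :
    Integrable fun t : ℝ => Complex.Gamma (a + t * I) * Complex.Gamma (d - t * I) := by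
  have hd' : Integrable fun t : ℝ => (‖d - t * I‖ ^ 2)⁻¹ := by
    refine (integrable_inv_normSq_add_mul_I hd).comp_neg.congr (.of_forall fun t => ?_)
    simp [sub_eq_add_neg]
  refine (((integrable_inv_normSq_add_mul_I ha).add hd').const_mul
    (Real.Gamma (a.re + 1) * Real.Gamma (d.re + 1))).mono'
    ((continuous_Gamma_add_mul_I ha).mul (continuous_Gamma_sub_mul_I hd)).aestronglyMeasurable
    (.of_forall fun t => ?_)
  have hat : 0 < (a + t * I).re := by simpa
  have hdt : 0 < (d - t * I).re := by simpa
  have hgt : ∀ {s : ℂ}, 0 < s.re → ‖Complex.Gamma s‖ ≤ Real.Gamma (s.re + 1) * ‖s‖⁻¹ := by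
    intro s hs
    have hs0 : s ≠ 0 := fun h => by simp [h] at hs
    have := norm_Gamma_le_Gamma_re (s := s + 1) (by simp; linarith)
    rw [Complex.Gamma_add_one s hs0, norm_mul, add_re, one_re] at this
    rw [← div_eq_mul_inv, le_div_iff₀ (norm_pos_iff.2 hs0)]
    linarith
  have h1 := hgt hat
  have h2 := hgt hdt
  simp only [add_re, sub_re, re_ofReal_mul, I_re, mul_zero, add_zero, sub_zero] at h1 h2
  have hGa := Real.Gamma_pos_of_pos (show 0 < a.re + 1 by linarith)
  have hGd := Real.Gamma_pos_of_pos (show 0 < d.re + 1 by linarith)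
  rw [norm_mul]
  refine (mul_le_mul h1 h2 (norm_nonneg _) (by positivity)).trans ?_
  rw [mul_mul_mul_comm]
  refine mul_le_mul_of_nonneg_left ?_ (by positivity)
  simp only [Pi.add_apply, ← inv_pow]
  nlinarith [sq_nonneg (‖a + t * I‖⁻¹ - ‖d - t * I‖⁻¹), sq_nonneg (‖a + t * I‖⁻¹),
    sq_nonneg (‖d - t * I‖⁻¹)]

theorem image_div_one_sub_Ioo : Set.image (fun m : ℝ => m / (1 - m)) (Ioo 0 1) = Ioi 0 := by
  ext x
  constructor
  · rintro ⟨m, hm, rfl⟩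
    exact div_pos hm.1 (sub_pos.2 hm.2)
  · intro (hx : 0 < x)
    refine ⟨x / (1 + x), ⟨by positivity, by rw [div_lt_one (by positivity)]; linarith⟩, ?_⟩
    field_simp
    simp

theorem injOn_div_one_sub : InjOn (fun m : ℝ => m / (1 - m)) (Ioo 0 1) := by
  intro x hx y hy h
  have : 1 - x ≠ 0 := (sub_pos.2 hx.2).ne'
  have : 1 - y ≠ 0 := (sub_pos.2 hy.2).ne'
  field_simp at h
  linarith

theorem hasDerivWithinAt_div_one_sub {m : ℝ} (hm : m ∈ Ioo (0 : ℝ) 1) :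
    HasDerivWithinAt (fun m : ℝ => m / (1 - m)) ((1 - m) ^ 2)⁻¹ (Ioo 0 1) m := by
  have h0 : 1 - m ≠ 0 := (sub_pos.2 hm.2).ne'
  have := (hasDerivAt_id m).div ((hasDerivAt_id m).const_sub 1) h0
  convert! this.hasDerivWithinAt using 1
  simp

theorem betaIntegral_eq_integral_Ioo (u v : ℂ) :
    betaIntegral u v = ∫ m in Ioo (0 : ℝ) 1, (m : ℂ) ^ (u - 1) * (1 - (m : ℂ)) ^ (v - 1) := by
  rw [betaIntegral, intervalIntegral.integral_of_le zero_le_one, integral_Ioc_eq_integral_Ioo]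

theorem integrableOn_betaIntegrand {u v : ℂ} (hu : 0 < u.re) (hv : 0 < v.re) :
    IntegrableOn (fun m : ℝ => (m : ℂ) ^ (u - 1) * (1 - (m : ℂ)) ^ (v - 1)) (Ioo 0 1) :=
  (intervalIntegrable_iff_integrableOn_Ioo_of_le zero_le_one).1 (betaIntegral_convergent hu hv)

theorem betaPrime_integrand_comp (u v : ℂ) {m : ℝ} (hm : m ∈ Ioo (0 : ℝ) 1) :
    |((1 - m) ^ 2)⁻¹| • (((m / (1 - m) : ℝ) : ℂ) ^ (u - 1) *
      (1 + ((m / (1 - m) : ℝ) : ℂ)) ^ (-(u + v))) =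
    (m : ℂ) ^ (u - 1) * (1 - (m : ℂ)) ^ (v - 1) := by
  have h1 : 0 < 1 - m := sub_pos.2 hm.2
  have hc : ((1 - m : ℝ) : ℂ) ≠ 0 := ofReal_ne_zero.2 h1.ne'
  have hadd : 1 + ((m / (1 - m) : ℝ) : ℂ) = ((1 - m : ℝ) : ℂ)⁻¹ := by
    push_cast at hc ⊢
    field_simp
    ring
  rw [hadd, abs_of_pos (by positivity), ofReal_div, div_cpow_ofReal_nonneg hm.1.le h1.le,
    inv_cpow _ _ (by rw [arg_ofReal_of_nonneg h1.le]; exact Real.pi_pos.ne), real_smul,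
    cpow_neg, inv_inv, show (1 : ℂ) - m = ((1 - m : ℝ) : ℂ) by push_cast; rfl,
    show u + v = (u - 1) + (v - 1) + 2 by ring, cpow_add _ _ hc, cpow_add _ _ hc]
  have : ((1 - m : ℝ) : ℂ) ^ (u - 1) ≠ 0 := fun h => hc ((cpow_eq_zero_iff _ _).1 h).1
  rw [cpow_ofNat]
  push_cast at hc this ⊢
  field_simp

theorem integrableOn_betaPrime {u v : ℂ} (hu : 0 < u.re) (hv : 0 < v.re) :
    IntegrableOn (fun x : ℝ => (x : ℂ) ^ (u - 1) * (1 + (x : ℂ)) ^ (-(u + v))) (Ioi 0) := by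
  rw [← image_div_one_sub_Ioo, integrableOn_image_iff_integrableOn_abs_deriv_smul measurableSet_Ioo
    (fun _ => hasDerivWithinAt_div_one_sub) injOn_div_one_sub]
  exact (integrableOn_betaIntegrand hu hv).congr_fun
    (fun m hm => (betaPrime_integrand_comp u v hm).symm) measurableSet_Ioo

theorem integral_betaPrime (u v : ℂ) :
    ∫ x in Ioi (0 : ℝ), (x : ℂ) ^ (u - 1) * (1 + (x : ℂ)) ^ (-(u + v)) = betaIntegral u v := by
  rw [← image_div_one_sub_Ioo, integral_image_eq_integral_abs_deriv_smul measurableSet_Ioo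
    (fun _ => hasDerivWithinAt_div_one_sub) injOn_div_one_sub, betaIntegral_eq_integral_Ioo]
  exact setIntegral_congr_fun measurableSet_Ioo fun m hm => betaPrime_integrand_comp u v hm

theorem integrable_betaIntegral {a d : ℂ} (ha : 0 < a.re) (hd : 0 < d.re) :
    Integrable fun t : ℝ => betaIntegral (a + t * I) (d - t * I) := by
  refine ((integrable_Gamma_mul_Gamma ha hd).div_const (Complex.Gamma (a + d))).congr
    (.of_forall fun t => ?_)
  simp only
  rw [betaIntegral_eq_Gamma_mul_div _ _ (by simpa) (by simpa)]
  congr 2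
  ring

/-- Mellin inversion for the Beta function. -/
theorem integral_cpow_mul_betaIntegral {a d : ℂ} (ha : 0 < a.re) (hd : 0 < d.re)
    {x : ℝ} (hx : 0 < x) :
    (1 / (2 * (Real.pi : ℂ))) *
      ∫ t : ℝ, (x : ℂ) ^ (-(t * I)) * betaIntegral (a + t * I) (d - t * I) =
    (x : ℂ) ^ a * (1 + (x : ℂ)) ^ (-(a + d)) := by
  set φ : ℝ → ℂ := fun x => (x : ℂ) ^ a * (1 + (x : ℂ)) ^ (-(a + d)) with hφ
  have key : ∀ (s : ℂ), ∀ y ∈ Ioi (0 : ℝ), (y : ℂ) ^ (s - 1) • φ y =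
      (y : ℂ) ^ (a + s - 1) * (1 + (y : ℂ)) ^ (-((a + s) + (d - s))) := by
    intro s y hy
    have hy0 : (y : ℂ) ≠ 0 := ofReal_ne_zero.2 (ne_of_gt hy)
    rw [hφ, smul_eq_mul, ← mul_assoc, ← cpow_add _ _ hy0]
    ring_nf
  have hm : ∀ s, mellin φ s = betaIntegral (a + s) (d - s) := fun s => by
    rw [mellin, setIntegral_congr_fun measurableSet_Ioi (key s), integral_betaPrime]
  have hconv : MellinConvergent φ ((0 : ℝ) : ℂ) :=
    (integrableOn_betaPrime (u := a + ((0 : ℝ) : ℂ)) (v := d - ((0 : ℝ) : ℂ)) (by simpa)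
      (by simpa)).congr_fun (fun y hy => (key _ y hy).symm) measurableSet_Ioi
  have hvert : VerticalIntegrable (mellin φ) 0 := by
    refine (integrable_betaIntegral ha hd).congr (.of_forall fun t => ?_)
    simp [hm]
  have hcont : ContinuousAt φ x := by
    refine ContinuousAt.mul (ContinuousAt.cpow (by fun_prop) continuousAt_const ?_)
      (ContinuousAt.cpow (by fun_prop) continuousAt_const ?_)
    · exact ofReal_mem_slitPlane.2 hx
    · exact_mod_cast ofReal_mem_slitPlane.2 (show 0 < 1 + x by linarith)
  have := mellinInv_mellin_eq 0 φ hx hconv hvert hcont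
  rw [mellinInv] at this
  change _ = φ x
  simpa [hm, real_smul] using this

theorem integral_mul_integral_cpow_swap {F g : ℝ → ℂ} {y : ℝ → ℝ} {s : Set ℝ}
    (hs : MeasurableSet s) (hF : Integrable F) (hg : IntegrableOn g s) (hy : Measurable y)
    (hpos : ∀ x ∈ s, 0 < y x) :
    ∫ t : ℝ, F t * ∫ x in s, g x * (y x : ℂ) ^ (t * I) =
      ∫ x in s, g x * ∫ t : ℝ, F t * (y x : ℂ) ^ (t * I) := by
  have hint : Integrable (Function.uncurry fun t x : ℝ => F t * g x * (y x : ℂ) ^ (t * I))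
      (volume.prod (volume.restrict s)) := by
    refine (hF.mul_prod hg).mul_bdd (c := 1) (Measurable.aestronglyMeasurable (by fun_prop)) ?_
    filter_upwards [Measure.quasiMeasurePreserving_snd.ae (ae_restrict_mem hs)] with p hp
    rw [norm_cpow_eq_rpow_re_of_pos (hpos _ hp)]
    simp
  simp_rw [← integral_const_mul]
  simp_rw [← mul_assoc]
  rw [integral_integral_swap hint]
  refine integral_congr_ae (.of_forall fun x => ?_)
  simp only [mul_comm (F _)]

theorem integrable_mul_cpow_mul_I {F : ℝ → ℂ} (hF : Integrable F) {z : ℝ} (hz : 0 < z) :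
    Integrable fun t : ℝ => F t * (z : ℂ) ^ (t * I) := by
  refine hF.mul_bdd (c := 1) (Measurable.aestronglyMeasurable (by fun_prop)) (.of_forall fun t => ?_)
  rw [norm_cpow_eq_rpow_re_of_pos hz]
  simp

theorem integrable_betaIntegral_mul_betaIntegral {a b d e : ℂ} (ha : 0 < a.re) (hb : 0 < b.re)
    (hd : 0 < d.re) (he : 0 < e.re) :
    Integrable fun t : ℝ =>
      betaIntegral (a + t * I) (d - t * I) * betaIntegral (b + t * I) (e - t * I) := by
  refine (integrable_betaIntegral ha hd).mul_bdd
    (c := Real.Gamma b.re * Real.Gamma e.re / ‖Complex.Gamma (b + e)‖)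
    (integrable_betaIntegral hb he).aestronglyMeasurable (.of_forall fun t => ?_)
  have hbt : 0 < (b + t * I).re := by simpa
  have het : 0 < (e - t * I).re := by simpa
  rw [betaIntegral_eq_Gamma_mul_div _ _ hbt het, norm_div, norm_mul,
    show b + t * I + (e - t * I) = b + e by ring]
  have h1 := norm_Gamma_le_Gamma_re hbt
  have h2 := norm_Gamma_le_Gamma_re het
  simp only [add_re, sub_re, re_ofReal_mul, I_re, mul_zero, add_zero, sub_zero] at h1 h2
  have := Real.Gamma_pos_of_pos hb
  gcongr

theorem betaIntegral_add_left_eq (c v w : ℂ) :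
    betaIntegral (c + w) v =
      ∫ z in Ioo (0 : ℝ) 1, ((z : ℂ) ^ (c - 1) * (1 - (z : ℂ)) ^ (v - 1)) * (z : ℂ) ^ w := by
  rw [betaIntegral_eq_integral_Ioo]
  refine setIntegral_congr_fun measurableSet_Ioo fun z hz => ?_
  have hz0 : (z : ℂ) ≠ 0 := ofReal_ne_zero.2 hz.1.ne'
  rw [show c + w - 1 = (c - 1) + w by ring, cpow_add _ _ hz0]
  ring

theorem betaIntegral_add_sub_eq (b e w : ℂ) :
    betaIntegral (b + w) (e - w) =
      ∫ m in Ioo (0 : ℝ) 1, ((m : ℂ) ^ (b - 1) * (1 - (m : ℂ)) ^ (e - 1)) *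
        ((m / (1 - m) : ℝ) : ℂ) ^ w := by
  rw [betaIntegral_eq_integral_Ioo]
  refine setIntegral_congr_fun measurableSet_Ioo fun m hm => ?_
  have hm0 : (m : ℂ) ≠ 0 := ofReal_ne_zero.2 hm.1.ne'
  have h1 : 0 < 1 - m := sub_pos.2 hm.2
  have h1c : ((1 - m : ℝ) : ℂ) ≠ 0 := ofReal_ne_zero.2 h1.ne'
  rw [ofReal_div, div_cpow_ofReal_nonneg hm.1.le h1.le,
    show (1 : ℂ) - m = ((1 - m : ℝ) : ℂ) by push_cast; rfl,
    show b + w - 1 = (b - 1) + w by ring, show e - w - 1 = (e - 1) - w by ring,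
    cpow_add _ _ hm0, cpow_sub _ _ h1c]
  ring

theorem integral_affine_Ioo (p q r : ℂ) {z : ℝ} (hz : z ∈ Ioo (0 : ℝ) 1) :
    ∫ m in Ioo (0 : ℝ) 1, (m : ℂ) ^ (p - 1) * (1 - (m : ℂ)) ^ (q - 1) *
        ((1 - (1 - z) * m : ℝ) : ℂ) ^ r =
      ((1 - z : ℝ) : ℂ) ^ (1 - p - q) *
        ∫ w in Ioo z 1, ((1 - w : ℝ) : ℂ) ^ (p - 1) * ((w - z : ℝ) : ℂ) ^ (q - 1) *
          (w : ℂ) ^ r := by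
  have h1 : 0 < 1 - z := sub_pos.2 hz.2
  have hc : ((1 - z : ℝ) : ℂ) ≠ 0 := ofReal_ne_zero.2 h1.ne'
  have key := intervalIntegral.integral_comp_sub_mul (a := 0) (b := 1)
    (fun w : ℝ => ((1 - w : ℝ) : ℂ) ^ (p - 1) * ((w - z : ℝ) : ℂ) ^ (q - 1) * (w : ℂ) ^ r)
    h1.ne' 1
  rw [mul_one, mul_zero, sub_zero, sub_sub_cancel, intervalIntegral.integral_of_le hz.2.le,
    intervalIntegral.integral_of_le zero_le_one, integral_Ioc_eq_integral_Ioo,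
    integral_Ioc_eq_integral_Ioo, real_smul, ofReal_inv, eq_inv_mul_iff_mul_eq₀ hc] at key
  rw [← key, ← mul_assoc, ← integral_const_mul]
  refine setIntegral_congr_fun measurableSet_Ioo fun m hm => ?_
  have e1 : ((1 - (1 - (1 - z) * m) : ℝ) : ℂ) = ((1 - z : ℝ) : ℂ) * (m : ℂ) := by
    push_cast; ring
  have e2 : ((1 - (1 - z) * m - z : ℝ) : ℂ) = ((1 - z : ℝ) : ℂ) * ((1 - m : ℝ) : ℂ) := by
    push_cast; ring
  rw [e1, e2, mul_cpow_ofReal_nonneg h1.le hm.1.le,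
    mul_cpow_ofReal_nonneg h1.le (sub_nonneg.2 hm.2.le),
    show (1 : ℂ) - m = ((1 - m : ℝ) : ℂ) by push_cast; rfl]
  have hpow : ((1 - z : ℝ) : ℂ) ^ (1 - p - q) * ((1 - z : ℝ) : ℂ) * (((1 - z : ℝ) : ℂ) ^ (p - 1) *
      ((1 - z : ℝ) : ℂ) ^ (q - 1)) = 1 := by
    rw [← cpow_add _ _ hc]
    nth_rw 2 [← cpow_one ((1 - z : ℝ) : ℂ)]
    rw [← cpow_add _ _ hc, ← cpow_add _ _ hc]
    ring_nf
    exact cpow_zero _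
  linear_combination (-(((m : ℝ) : ℂ) ^ (p - 1) * ((1 - m : ℝ) : ℂ) ^ (q - 1) *
    ((1 - (1 - z) * m : ℝ) : ℂ) ^ r)) * hpow

theorem integral_betaIntegral_mul_betaIntegral_mul_cpow {a b d e : ℂ} (ha : 0 < a.re)
    (hb : 0 < b.re) (hd : 0 < d.re) (he : 0 < e.re) {z : ℝ} (hz : z ∈ Ioo (0 : ℝ) 1) :
    (1 / (2 * (Real.pi : ℂ))) * ∫ t : ℝ, betaIntegral (a + t * I) (d - t * I) *
      betaIntegral (b + t * I) (e - t * I) * (z : ℂ) ^ (t * I) =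
    (z : ℂ) ^ d * ((1 - z : ℝ) : ℂ) ^ (1 - (b + d) - (e + a)) *
      ∫ w in Ioo z 1, ((1 - w : ℝ) : ℂ) ^ (b + d - 1) * ((w - z : ℝ) : ℂ) ^ (e + a - 1) *
        (w : ℂ) ^ (-(a + d)) := by
  have hF := integrable_mul_cpow_mul_I (integrable_betaIntegral ha hd) hz.1
  have hswap := integral_mul_integral_cpow_swap (s := Ioo (0 : ℝ) 1) (y := fun m => m / (1 - m))
    measurableSet_Ioo hF (integrableOn_betaIntegrand hb he) (by fun_prop)
    (fun m hm => div_pos hm.1 (sub_pos.2 hm.2))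
  simp_rw [← betaIntegral_add_sub_eq] at hswap
  simp_rw [mul_right_comm _ (betaIntegral (b + _) _)]
  rw [hswap, mul_assoc, ← integral_affine_Ioo _ _ _ hz, ← integral_const_mul,
    ← integral_const_mul]
  refine setIntegral_congr_fun measurableSet_Ioo fun m hm => ?_
  have h1 : 0 < 1 - m := sub_pos.2 hm.2
  have hmc : (m : ℂ) ≠ 0 := ofReal_ne_zero.2 hm.1.ne'
  have hzc : (z : ℂ) ≠ 0 := ofReal_ne_zero.2 hz.1.ne'
  have h1c : ((1 - m : ℝ) : ℂ) ≠ 0 := ofReal_ne_zero.2 h1.ne'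
  have hq : 0 < 1 - (1 - z) * m := by nlinarith [hz.1, hz.2, hm.1, hm.2]
  have hmz : 0 < m * z := mul_pos hm.1 hz.1
  have hx : 0 < (1 - m) / (m * z) := div_pos h1 hmz
  have hinv := integral_cpow_mul_betaIntegral ha hd hx
  have hcpow : ∀ t : ℝ, (((1 - m) / (m * z) : ℝ) : ℂ) ^ (-(t * I)) =
      (z : ℂ) ^ (t * I) * ((m / (1 - m) : ℝ) : ℂ) ^ (t * I) := by
    intro t
    rw [← mul_cpow_ofReal_nonneg hz.1.le (div_pos hm.1 h1).le, cpow_neg, ← inv_cpow]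
    · push_cast
      congr 1
      push_cast at h1c
      field_simp
    · rw [arg_ofReal_of_nonneg hx.le]; exact Real.pi_pos.ne
  have hadd : 1 + (((1 - m) / (m * z) : ℝ) : ℂ) = (((1 - (1 - z) * m) / (m * z) : ℝ) : ℂ) := by
    push_cast
    field_simp
    ring
  rw [hadd, ofReal_div, ofReal_div, div_cpow_ofReal_nonneg h1.le hmz.le,
    div_cpow_ofReal_nonneg hq.le hmz.le, cpow_neg ((m * z : ℝ) : ℂ),
    cpow_add _ _ (by simp [hmc, hzc]),
    ofReal_mul, mul_cpow_ofReal_nonneg hm.1.le hz.1.le,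
    mul_cpow_ofReal_nonneg hm.1.le hz.1.le] at hinv
  have hI : ∫ t : ℝ, betaIntegral (a + t * I) (d - t * I) * (z : ℂ) ^ (t * I) *
      ((m / (1 - m) : ℝ) : ℂ) ^ (t * I) =
      ∫ t : ℝ, (((1 - m) / (m * z) : ℝ) : ℂ) ^ (-(t * I)) *
        betaIntegral (a + t * I) (d - t * I) := by
    refine integral_congr_ae (.of_forall fun t => ?_)
    simp only [hcpow]
    ring
  rw [hI, mul_left_comm]
  have hinv' : (1 / (2 * (Real.pi : ℂ))) * ∫ t : ℝ, (((1 - m) / (m * z) : ℝ) : ℂ) ^ (-(t * I)) *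
        betaIntegral (a + t * I) (d - t * I) = (z : ℂ) ^ d * (m : ℂ) ^ d *
        ((1 - m : ℝ) : ℂ) ^ a * ((1 - (1 - z) * m : ℝ) : ℂ) ^ (-(a + d)) := by
    have n1 : (m : ℂ) ^ a ≠ 0 := fun h => hmc ((cpow_eq_zero_iff _ _).1 h).1
    have n2 : (z : ℂ) ^ a ≠ 0 := fun h => hzc ((cpow_eq_zero_iff _ _).1 h).1
    rw [ofReal_div, ofReal_mul, hinv]
    field_simp
  rw [hinv', show b + d - 1 = (b - 1) + d by ring, show e + a - 1 = (e - 1) + a by ring,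
    show (1 : ℂ) - m = ((1 - m : ℝ) : ℂ) by push_cast; rfl, cpow_add _ _ hmc, cpow_add _ _ h1c]
  ring

theorem integral_norm_betaIntegrand_scaled (s t : ℂ) {w : ℝ} (hw : 0 < w) :
    ∫ z in Ioo (0 : ℝ) w, ‖(z : ℂ) ^ (s - 1) * ((w - z : ℝ) : ℂ) ^ (t - 1)‖ =
      w ^ (s + t - 1).re *
        ∫ z in Ioo (0 : ℝ) 1, ‖(z : ℂ) ^ (s - 1) * ((1 - z : ℝ) : ℂ) ^ (t - 1)‖ := by
  have key := intervalIntegral.integral_comp_mul_left (a := 0) (b := 1)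
    (fun z : ℝ => ‖(z : ℂ) ^ (s - 1) * ((w - z : ℝ) : ℂ) ^ (t - 1)‖) hw.ne'
  rw [mul_one, mul_zero, intervalIntegral.integral_of_le hw.le,
    intervalIntegral.integral_of_le zero_le_one, integral_Ioc_eq_integral_Ioo,
    integral_Ioc_eq_integral_Ioo, smul_eq_mul, eq_inv_mul_iff_mul_eq₀ hw.ne'] at key
  rw [← key, ← integral_const_mul, ← integral_const_mul]
  refine setIntegral_congr_fun measurableSet_Ioo fun z hz => ?_
  have h1 : 0 < 1 - z := sub_pos.2 hz.2
  simp only [norm_mul]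
  rw [show w - w * z = w * (1 - z) by ring, norm_cpow_eq_rpow_re_of_pos (mul_pos hw hz.1),
    norm_cpow_eq_rpow_re_of_pos (mul_pos hw h1), norm_cpow_eq_rpow_re_of_pos hz.1,
    norm_cpow_eq_rpow_re_of_pos h1, Real.mul_rpow hw.le hz.1.le, Real.mul_rpow hw.le h1.le]
  have hpow : w * (w ^ (s - 1).re * w ^ (t - 1).re) = w ^ (s + t - 1).re := by
    rw [← Real.rpow_add hw]
    nth_rw 1 [← Real.rpow_one w]
    rw [← Real.rpow_add hw]
    simp only [sub_re, add_re, one_re]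
    ring_nf
  rw [← hpow]
  ring

theorem integrableOn_betaIntegrand_scaled {s t : ℂ} (hs : 0 < s.re) (ht : 0 < t.re) {w : ℝ}
    (hw : 0 < w) :
    IntegrableOn (fun z : ℝ => (z : ℂ) ^ (s - 1) * ((w - z : ℝ) : ℂ) ^ (t - 1)) (Ioo 0 w) := by
  have h := (betaIntegral_convergent hs ht).comp_mul_left (c := w⁻¹)
  rw [zero_div, one_div, inv_inv, intervalIntegrable_iff_integrableOn_Ioo_of_le hw.le] at h
  refine IntegrableOn.congr_fun (h.const_mul ((w : ℂ) ^ (s - 1) * (w : ℂ) ^ (t - 1)))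
    (fun z hz => ?_) measurableSet_Ioo
  have h1 : 0 < w - z := sub_pos.2 hz.2
  have hwc : (w : ℂ) ≠ 0 := ofReal_ne_zero.2 hw.ne'
  have e1 : (z : ℂ) = (w : ℂ) * ((w⁻¹ * z : ℝ) : ℂ) := by push_cast; field_simp
  have e2 : ((w - z : ℝ) : ℂ) = (w : ℂ) * ((w⁻¹ * (w - z) : ℝ) : ℂ) := by push_cast; field_simp
  have e3 : (1 : ℂ) - ((w⁻¹ * z : ℝ) : ℂ) = ((w⁻¹ * (w - z) : ℝ) : ℂ) := by push_cast; field_simp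
  have hz0 : 0 ≤ w⁻¹ * z := mul_nonneg (inv_nonneg.2 hw.le) hz.1.le
  have hz1 : 0 ≤ w⁻¹ * (w - z) := mul_nonneg (inv_nonneg.2 hw.le) h1.le
  rw [e2, mul_cpow_ofReal_nonneg hw.le hz1]
  conv_rhs => rw [e1, mul_cpow_ofReal_nonneg hw.le hz0]
  rw [e3]
  ring

/-- Fubini's theorem over the triangle `0 < z < w < 1`. -/
theorem integral_Ioo_integral_betaIntegrand {s t : ℂ} (hs : 0 < s.re) (ht : 0 < t.re) {h : ℝ → ℂ}
    (hm : Measurable h)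
    (hint : IntegrableOn (fun w : ℝ => (w : ℂ) ^ (s + t - 1) * h w) (Ioo 0 1)) :
    ∫ z in Ioo (0 : ℝ) 1, ∫ w in Ioo z 1,
      (z : ℂ) ^ (s - 1) * ((w - z : ℝ) : ℂ) ^ (t - 1) * h w =
    betaIntegral s t * ∫ w in Ioo (0 : ℝ) 1, (w : ℂ) ^ (s + t - 1) * h w := by
  set K : ℝ → ℝ → ℂ := fun z w => (z : ℂ) ^ (s - 1) * ((w - z : ℝ) : ℂ) ^ (t - 1) * h w with hK
  set f : ℝ → ℝ → ℂ := fun z w => (Ioi z).indicator (K z) w with hf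
  have hfw : ∀ w, (fun z => f z w) = (Iio w).indicator (fun z => K z w) := by
    intro w
    ext z
    simp [hf, indicator_apply]
  have hfn : ∀ w, (fun z => ‖f z w‖) = (Iio w).indicator (fun z => ‖K z w‖) := by
    intro w
    ext z
    rw [congrFun (hfw w) z, norm_indicator_eq_indicator_norm]
  have hset : ∀ w ∈ Ioo (0 : ℝ) 1, Ioo (0 : ℝ) 1 ∩ Iio w = Ioo 0 w := by
    intro w hw
    ext z
    simp only [mem_inter_iff, mem_Ioo, mem_Iio]
    exact ⟨fun h => ⟨h.1.1, h.2⟩, fun h => ⟨⟨h.1, h.2.trans hw.2⟩, h.2⟩⟩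
  have hset' : ∀ z ∈ Ioo (0 : ℝ) 1, Ioo (0 : ℝ) 1 ∩ Ioi z = Ioo z 1 := by
    intro z hz
    ext w
    simp only [mem_inter_iff, mem_Ioo, mem_Ioi]
    exact ⟨fun h => ⟨h.2, h.1.2⟩, fun h => ⟨⟨hz.1.trans h.1, h.2⟩, h.1⟩⟩
  have hmeas : Measurable (Function.uncurry f) := by
    have : Function.uncurry f = {p : ℝ × ℝ | p.1 < p.2}.indicator (Function.uncurry K) := by
      ext ⟨z, w⟩
      simp [hf, indicator_apply, Function.uncurry]
    rw [this]
    refine Measurable.indicator ?_ (measurableSet_lt measurable_fst measurable_snd)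
    simp only [hK, Function.uncurry_def]
    fun_prop
  have hprod : Integrable (Function.uncurry f)
      ((volume.restrict (Ioo (0 : ℝ) 1)).prod (volume.restrict (Ioo (0 : ℝ) 1))) := by
    refine (integrable_prod_iff' hmeas.aestronglyMeasurable).2 ⟨?_, ?_⟩
    · refine (ae_restrict_iff' measurableSet_Ioo).2 (.of_forall fun w hw => ?_)
      simp only [Function.uncurry_apply_pair, hfw]
      rw [integrable_indicator_iff measurableSet_Iio, IntegrableOn, Measure.restrict_restrict
        measurableSet_Iio, inter_comm, hset w hw]
      exact (integrableOn_betaIntegrand_scaled hs ht hw.1).mul_const (h w)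
    · simp only [Function.uncurry_apply_pair, hfn]
      refine IntegrableOn.congr_fun (hint.norm.mul_const
        (∫ z in Ioo (0 : ℝ) 1, ‖(z : ℂ) ^ (s - 1) * ((1 - z : ℝ) : ℂ) ^ (t - 1)‖))
        (fun w hw => ?_) measurableSet_Ioo
      rw [setIntegral_indicator measurableSet_Iio, hset w hw]
      simp only [hK, norm_mul _ (h w)]
      rw [integral_mul_const, integral_norm_betaIntegrand_scaled s t hw.1,
        norm_cpow_eq_rpow_re_of_pos hw.1]
      ring
  have h1 : ∫ z in Ioo (0 : ℝ) 1, ∫ w in Ioo z 1, K z w =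
      ∫ z in Ioo (0 : ℝ) 1, ∫ w in Ioo (0 : ℝ) 1, f z w := by
    refine setIntegral_congr_fun measurableSet_Ioo fun z hz => ?_
    simp only [hf]
    rw [setIntegral_indicator measurableSet_Ioi, hset' z hz]
  rw [h1, integral_integral_swap hprod, ← integral_const_mul]
  refine setIntegral_congr_fun measurableSet_Ioo fun w hw => ?_
  simp only [hfw]
  rw [setIntegral_indicator measurableSet_Iio, hset w hw, integral_mul_const,
    ← integral_Ioc_eq_integral_Ioo, ← intervalIntegral.integral_of_le hw.1.le]
  have := betaIntegral_scaled s t hw.1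
  simp only [ofReal_sub]
  rw [this]
  ring

theorem integral_betaIntegral_mul_betaIntegral_mul_betaIntegral {a b c d e : ℂ} (ha : 0 < a.re)
    (hb : 0 < b.re) (hc : 0 < c.re) (hd : 0 < d.re) (he : 0 < e.re) :
    (1 / (2 * (Real.pi : ℂ))) * ∫ t : ℝ, betaIntegral (a + t * I) (d - t * I) *
      betaIntegral (b + t * I) (e - t * I) * betaIntegral (c + t * I) (a + b + d + e) =
    betaIntegral (c + d) (e + a) * betaIntegral (e + c) (b + d) := by
  have hS : 0 < (a + b + d + e).re := by simp only [add_re]; linarith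
  have hswap := integral_mul_integral_cpow_swap (s := Ioo (0 : ℝ) 1) (y := fun z => z)
    measurableSet_Ioo (integrable_betaIntegral_mul_betaIntegral ha hb hd he)
    (integrableOn_betaIntegrand hc hS) measurable_id (fun z hz => hz.1)
  simp_rw [← betaIntegral_add_left_eq] at hswap
  have hpow : ∀ w ∈ Ioo (0 : ℝ) 1, (w : ℂ) ^ (c + d + (e + a) - 1) *
      (((1 - w : ℝ) : ℂ) ^ (b + d - 1) * (w : ℂ) ^ (-(a + d))) =
      (w : ℂ) ^ (e + c - 1) * (1 - (w : ℂ)) ^ (b + d - 1) := by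
    intro w hw
    rw [mul_left_comm, ← cpow_add _ _ (ofReal_ne_zero.2 hw.1.ne'), mul_comm]
    push_cast
    ring_nf
  have hint := (integrableOn_betaIntegrand (u := e + c) (v := b + d)
    (by simp only [add_re]; linarith) (by simp only [add_re]; linarith)).congr_fun
    (fun w hw => (hpow w hw).symm) measurableSet_Ioo
  have hfub := integral_Ioo_integral_betaIntegrand (s := c + d) (t := e + a)
    (by simp only [add_re]; linarith) (by simp only [add_re]; linarith)
    (h := fun w => ((1 - w : ℝ) : ℂ) ^ (b + d - 1) * (w : ℂ) ^ (-(a + d))) (by fun_prop) hint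
  rw [setIntegral_congr_fun measurableSet_Ioo hpow, ← betaIntegral_eq_integral_Ioo] at hfub
  rw [hswap, ← hfub, ← integral_const_mul]
  refine setIntegral_congr_fun measurableSet_Ioo fun z hz => ?_
  have hzc : (z : ℂ) ≠ 0 := ofReal_ne_zero.2 hz.1.ne'
  have h1c : ((1 - z : ℝ) : ℂ) ≠ 0 := ofReal_ne_zero.2 (sub_pos.2 hz.2).ne'
  have hinner := integral_betaIntegral_mul_betaIntegral_mul_cpow ha hb hd he hz
  rw [mul_left_comm, hinner, ← integral_const_mul, ← integral_const_mul]
  refine setIntegral_congr_fun measurableSet_Ioo fun w hw => ?_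
  have hone : ((1 - z : ℝ) : ℂ) ^ (a + b + d + e - 1) *
      ((1 - z : ℝ) : ℂ) ^ (1 - (b + d) - (e + a)) = 1 := by
    rw [← cpow_add _ _ h1c]
    ring_nf
    exact cpow_zero _
  rw [show c + d - 1 = (c - 1) + d by ring, cpow_add _ _ hzc,
    show (1 : ℂ) - z = ((1 - z : ℝ) : ℂ) by push_cast; rfl]
  linear_combination ((z : ℂ) ^ (c - 1) * (z : ℂ) ^ d * ((1 - w : ℝ) : ℂ) ^ (b + d - 1) *
    ((w - z : ℝ) : ℂ) ^ (e + a - 1) * (w : ℂ) ^ (-(a + d))) * hone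

/-- Barnes's second lemma for the contour `Re w = 0`. -/
theorem second_barnes_lemma_imaginary_axis {a b c d e f : ℂ} (hf : f = a + b + c + d + e)
    (ha : 0 < a.re) (hb : 0 < b.re) (hc : 0 < c.re) (hd : 0 < d.re) (he : 0 < e.re) :
    (1 / (2 * (Real.pi : ℂ))) *
      ∫ t : ℝ,
        Complex.Gamma (a + t * I) * Complex.Gamma (b + t * I) *
          Complex.Gamma (c + t * I) * Complex.Gamma (d - t * I) *
          Complex.Gamma (e - t * I) / Complex.Gamma (f + t * I) =
    Complex.Gamma (d + a) * Complex.Gamma (d + b) * Complex.Gamma (d + c) *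
      Complex.Gamma (e + a) * Complex.Gamma (e + b) * Complex.Gamma (e + c) /
      (Complex.Gamma (f - a) * Complex.Gamma (f - b) * Complex.Gamma (f - c)) := by
  have hpos : ∀ {s : ℂ}, 0 < s.re → Complex.Gamma s ≠ 0 := Gamma_ne_zero_of_re_pos
  have hS : Complex.Gamma (a + b + d + e) ≠ 0 := hpos (by simp only [add_re]; linarith)
  have hda : Complex.Gamma (d + a) ≠ 0 := hpos (by simp only [add_re]; linarith)
  have heb : Complex.Gamma (e + b) ≠ 0 := hpos (by simp only [add_re]; linarith)
  have hint : ∀ t : ℝ, Complex.Gamma (a + t * I) * Complex.Gamma (b + t * I) *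
      Complex.Gamma (c + t * I) * Complex.Gamma (d - t * I) *
      Complex.Gamma (e - t * I) / Complex.Gamma (f + t * I) =
      Complex.Gamma (d + a) * Complex.Gamma (e + b) / Complex.Gamma (a + b + d + e) *
      (betaIntegral (a + t * I) (d - t * I) * betaIntegral (b + t * I) (e - t * I) *
        betaIntegral (c + t * I) (a + b + d + e)) := by
    intro t
    rw [betaIntegral_eq_Gamma_mul_div _ _ (by simpa) (by simpa),
      betaIntegral_eq_Gamma_mul_div _ _ (by simpa) (by simpa),
      betaIntegral_eq_Gamma_mul_div (c + t * I) _ (by simpa) (by simp only [add_re]; linarith),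
      show a + t * I + (d - t * I) = d + a by ring, show b + t * I + (e - t * I) = e + b by ring,
      show c + t * I + (a + b + d + e) = f + t * I by rw [hf]; ring]
    have : Complex.Gamma (f + t * I) ≠ 0 := hpos (by simp [hf]; linarith)
    field_simp
  simp_rw [hint]
  rw [integral_const_mul, mul_left_comm,
    integral_betaIntegral_mul_betaIntegral_mul_betaIntegral ha hb hc hd he,
    betaIntegral_eq_Gamma_mul_div _ _ (by simp only [add_re]; linarith)
      (by simp only [add_re]; linarith),
    betaIntegral_eq_Gamma_mul_div _ _ (by simp only [add_re]; linarith)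
      (by simp only [add_re]; linarith),
    show f - a = e + c + (b + d) by rw [hf]; ring, show f - b = c + d + (e + a) by rw [hf]; ring,
    show f - c = a + b + d + e by rw [hf]; ring, add_comm c d, add_comm b d]
  have h1 : Complex.Gamma (e + c + (d + b)) ≠ 0 := hpos (by simp only [add_re]; linarith)
  have h2 : Complex.Gamma (d + c + (e + a)) ≠ 0 := hpos (by simp only [add_re]; linarith)
  field_simp

/-- **Second Barnes Lemma.** -/
theorem second_barnes_lemma (a b c d e f : ℂ) (hf : f = a + b + c + d + e)
    (σ : ℝ) (hσ₁ : max (max (-a.re) (-b.re)) (-c.re) < σ) (hσ₂ : σ < min d.re e.re) :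
    (1 / (2 * (Real.pi : ℂ))) *
      ∫ t : ℝ,
        Complex.Gamma (σ + t * I + a) * Complex.Gamma (σ + t * I + b) *
          Complex.Gamma (σ + t * I + c) * Complex.Gamma (d - σ - t * I) *
          Complex.Gamma (e - σ - t * I) / Complex.Gamma (σ + t * I + f) =
    Complex.Gamma (d + a) * Complex.Gamma (d + b) * Complex.Gamma (d + c) *
      Complex.Gamma (e + a) * Complex.Gamma (e + b) * Complex.Gamma (e + c) /
      (Complex.Gamma (f - a) * Complex.Gamma (f - b) * Complex.Gamma (f - c)) := by
  simp only [max_lt_iff, lt_min_iff] at hσ₁ hσ₂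
  obtain ⟨⟨ha, hb⟩, hc⟩ := hσ₁
  obtain ⟨hd, he⟩ := hσ₂
  have key := second_barnes_lemma_imaginary_axis (a := σ + a) (b := σ + b) (c := σ + c)
    (d := d - σ) (e := e - σ) (f := σ + f) (by rw [hf]; ring)
    (by simp only [add_re, ofReal_re]; linarith) (by simp only [add_re, ofReal_re]; linarith)
    (by simp only [add_re, ofReal_re]; linarith) (by simp only [sub_re, ofReal_re]; linarith)
    (by simp only [sub_re, ofReal_re]; linarith)
  simp only [← add_assoc, sub_add_cancel, add_sub_add_left_eq_sub] at key
  simpa only [add_right_comm] using key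
end

section
/- For real numbers t₀, t₁, v define E(t₀, t₁, v) := 3|t₁| + 3|t₀ − v| − |t₁ − 2t₀| + |v + t₁ − t₀| + |t₀ + v| − |t₀ + t₁ − v|. Then for all t₀, t₁, v ∈ ℝ one has E(t₀, t₁, v) ≥ 2(|t₁| + |t₀ − v|) ≥ 0, and E(t₀, t₁, v) = 0 if and only if t₁ = 0 and t₀ = v. -/
/-- The exponential phase `E(t₀,t₁,v)` arising from Stirling's formula is nonnegative,
bounded below by `2(|t₁| + |t₀ − v|)`, and vanishes exactly when `t₁ = 0` and `t₀ = v`. -/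
theorem exponential_phase_nonneg (t₀ t₁ v : ℝ) :
    (3 * |t₁| + 3 * |t₀ - v| - |t₁ - 2 * t₀| + |v + t₁ - t₀| + |t₀ + v| - |t₀ + t₁ - v|
        ≥ 2 * (|t₁| + |t₀ - v|) ∧
      2 * (|t₁| + |t₀ - v|) ≥ 0) ∧
    (3 * |t₁| + 3 * |t₀ - v| - |t₁ - 2 * t₀| + |v + t₁ - t₀| + |t₀ + v| - |t₀ + t₁ - v| = 0
      ↔ t₁ = 0 ∧ t₀ = v) := by
  have h₁ : |t₁ - 2 * t₀| ≤ |v + t₁ - t₀| + |t₀ + v| := by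
    simpa only [show v + t₁ - t₀ - (t₀ + v) = t₁ - 2 * t₀ by ring] using
      abs_sub (v + t₁ - t₀) (t₀ + v)
  have h₂ : |t₀ + t₁ - v| ≤ |t₁| + |t₀ - v| := by
    simpa only [show t₁ + (t₀ - v) = t₀ + t₁ - v by ring] using abs_add_le t₁ (t₀ - v)
  have h₃ := abs_nonneg t₁
  have h₄ := abs_nonneg (t₀ - v)
  refine ⟨⟨by linarith, by linarith⟩, fun h => ⟨?_, ?_⟩, ?_⟩
  · exact abs_eq_zero.mp (by linarith)
  · exact sub_eq_zero.mp (abs_eq_zero.mp (by linarith))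
  · rintro ⟨rfl, rfl⟩
    simp [← two_mul]
end

section
/- Mellin transform of the GL(2) Whittaker function: Let μ, w ∈ ℂ with Re(w + 1/2 + μ) > 0 and Re(w + 1/2 − μ) > 0. Then ∫₀^∞ W_μ(y) · y^{w−1} dy = (π^{−w−1/2}/2) · Γ((w + 1/2 + μ)/2) · Γ((w + 1/2 − μ)/2). -/
open Complex MeasureTheory Set

/-- The K-Bessel function `K_μ(x) = ∫₀^∞ exp(−x cosh t) cosh(μt) dt`. -/
noncomputable def KBessel (μ : ℂ) (x : ℝ) : ℂ :=
  ∫ t in Ioi (0:ℝ), Complex.exp (-(x : ℂ) * (Real.cosh t : ℂ)) * Complex.cosh (μ * (t : ℂ))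

/-- The GL(2) Whittaker function `W_μ(y) = 2√y K_μ(2πy)`. -/
noncomputable def W2 (μ : ℂ) (y : ℝ) : ℂ :=
  2 * (Real.sqrt y : ℂ) * KBessel μ (2 * Real.pi * y)

lemma ofReal_exp_cpow (a : ℝ) (u : ℂ) : ((Real.exp a : ℝ) : ℂ) ^ u = Complex.exp (a * u) := by
  rw [cpow_def_of_ne_zero (ofReal_ne_zero.mpr (Real.exp_pos a).ne'),
    ← ofReal_log (Real.exp_pos a).le, Real.log_exp]

lemma sigmoid_two_mul (t : ℝ) :
    Real.sigmoid (2 * t) = Real.exp (t - Real.log (2 * Real.cosh t)) := by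
  have hc : 0 < 2 * Real.cosh t := mul_pos two_pos (Real.cosh_pos t)
  rw [Real.exp_sub, Real.exp_log hc, Real.sigmoid_def, Real.cosh_eq, eq_div_iff (by positivity),
    mul_div_cancel₀ _ two_ne_zero, inv_mul_eq_iff_eq_mul₀ (by positivity), add_mul, ← Real.exp_add]
  ring_nf

lemma one_sub_sigmoid_two_mul (t : ℝ) :
    1 - Real.sigmoid (2 * t) = Real.exp (-t - Real.log (2 * Real.cosh t)) := by
  rw [← Real.sigmoid_neg, ← mul_neg, sigmoid_two_mul, Real.cosh_neg]

/-- The pull-back of the Beta integrand under `t ↦ sigmoid (2t)`. -/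
lemma abs_deriv_smul_beta_integrand (u v : ℂ) (t : ℝ) :
    |Real.sigmoid (2 * t) * (1 - Real.sigmoid (2 * t)) * 2| •
      (((Real.sigmoid (2 * t) : ℝ) : ℂ) ^ (u - 1) *
        (1 - ((Real.sigmoid (2 * t) : ℝ) : ℂ)) ^ (v - 1)) =
    2 * (Complex.exp ((u - v) * t) * ((2 * Real.cosh t : ℝ) : ℂ) ^ (-(u + v))) := by
  have hc : 0 < 2 * Real.cosh t := mul_pos two_pos (Real.cosh_pos t)
  rw [← ofReal_one, ← ofReal_sub, one_sub_sigmoid_two_mul, sigmoid_two_mul,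
    abs_of_pos (by positivity), ofReal_exp_cpow, ofReal_exp_cpow]
  nth_rw 5 [← Real.exp_log hc]
  rw [ofReal_exp_cpow, real_smul]
  push_cast
  rw [mul_right_comm, mul_comm _ (2 : ℂ), mul_assoc]
  simp only [← Complex.exp_add]
  congr 2
  ring

lemma hasDerivWithinAt_sigmoid_two_mul (s : Set ℝ) (t : ℝ) :
    HasDerivWithinAt (fun t ↦ Real.sigmoid (2 * t))
      (Real.sigmoid (2 * t) * (1 - Real.sigmoid (2 * t)) * 2) s t := by
  have h := (Real.hasDerivAt_sigmoid (2 * t)).comp t ((hasDerivAt_id t).const_mul 2)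
  rw [mul_one] at h
  exact h.hasDerivWithinAt

lemma injective_sigmoid_two_mul : Function.Injective fun t : ℝ ↦ Real.sigmoid (2 * t) :=
  fun a b h ↦ by simpa using Real.sigmoid_injective h

lemma image_sigmoid_two_mul : (fun t : ℝ ↦ Real.sigmoid (2 * t)) '' univ = Ioo 0 1 := by
  rw [image_univ, ← Real.range_sigmoid]
  exact (mul_left_surjective₀ (two_ne_zero' ℝ)).range_comp Real.sigmoid

/-- The Beta integral on the real line, in hyperbolic coordinates: integrability. -/
lemma integrable_exp_mul_cosh_cpow {u v : ℂ} (hu : 0 < u.re) (hv : 0 < v.re) :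
    Integrable fun t : ℝ ↦
      Complex.exp ((u - v) * t) * ((2 * Real.cosh t : ℝ) : ℂ) ^ (-(u + v)) := by
  have h := betaIntegral_convergent hu hv
  rw [intervalIntegrable_iff_integrableOn_Ioo_of_le zero_le_one, ← image_sigmoid_two_mul,
    integrableOn_image_iff_integrableOn_abs_deriv_smul MeasurableSet.univ
      (fun t _ ↦ hasDerivWithinAt_sigmoid_two_mul univ t) injective_sigmoid_two_mul.injOn,
    integrableOn_univ] at h
  simp_rw [abs_deriv_smul_beta_integrand] at h
  simpa using h.const_mul (1 / 2)

/-- The Beta integral on the real line, in hyperbolic coordinates. -/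
lemma integral_exp_mul_cosh_cpow (u v : ℂ) :
    ∫ t : ℝ, Complex.exp ((u - v) * t) * ((2 * Real.cosh t : ℝ) : ℂ) ^ (-(u + v)) =
      betaIntegral u v / 2 := by
  rw [betaIntegral, intervalIntegral.integral_of_le zero_le_one, integral_Ioc_eq_integral_Ioo,
    ← image_sigmoid_two_mul,
    integral_image_eq_integral_abs_deriv_smul MeasurableSet.univ
      (fun t _ ↦ hasDerivWithinAt_sigmoid_two_mul univ t) injective_sigmoid_two_mul.injOn,
    Measure.restrict_univ]
  simp_rw [abs_deriv_smul_beta_integrand]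
  rw [integral_const_mul, mul_div_cancel_left₀ _ two_ne_zero]

lemma exp_mul_cosh_cpow_add_neg (μ s : ℂ) (t : ℝ) :
    Complex.exp (μ * t) * ((2 * Real.cosh t : ℝ) : ℂ) ^ (-s) +
      Complex.exp (μ * (-t : ℝ)) * ((2 * Real.cosh (-t) : ℝ) : ℂ) ^ (-s) =
    2 * (Complex.cosh (μ * t) * ((2 * Real.cosh t : ℝ) : ℂ) ^ (-s)) := by
  rw [Real.cosh_neg, Complex.cosh, ofReal_neg, mul_neg]
  ring

lemma integrableOn_cosh_mul_cosh_cpow {u v : ℂ} (hu : 0 < u.re) (hv : 0 < v.re) :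
    IntegrableOn (fun t : ℝ ↦
      Complex.cosh ((u - v) * t) * ((2 * Real.cosh t : ℝ) : ℂ) ^ (-(u + v))) (Ioi 0) := by
  have h := integrable_exp_mul_cosh_cpow hu hv
  have h2 := (h.add h.comp_neg).const_mul (1 / 2)
  simp only [Pi.add_apply, exp_mul_cosh_cpow_add_neg] at h2
  refine Integrable.integrableOn ?_
  simpa using h2

lemma integral_cosh_mul_cosh_cpow {u v : ℂ} (hu : 0 < u.re) (hv : 0 < v.re) :
    ∫ t in Ioi (0 : ℝ), Complex.cosh ((u - v) * t) * ((2 * Real.cosh t : ℝ) : ℂ) ^ (-(u + v)) =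
      betaIntegral u v / 4 := by
  have h := integrable_exp_mul_cosh_cpow hu hv
  have key := integral_exp_mul_cosh_cpow u v
  rw [← intervalIntegral.integral_Iic_add_Ioi (b := 0) h.integrableOn h.integrableOn, ← neg_zero,
    ← integral_comp_neg_Ioi, neg_zero, add_comm,
    ← integral_add h.integrableOn h.comp_neg.integrableOn] at key
  simp_rw [exp_mul_cosh_cpow_add_neg] at key
  rw [integral_const_mul] at key
  linear_combination key / 2

/-- The norm of the Gamma integrand. -/
lemma norm_cpow_mul_exp_neg_mul {s : ℂ} {r y : ℝ} (hy : 0 < y) :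
    ‖(y : ℂ) ^ (s - 1) * Complex.exp (-(r * y))‖ = y ^ (s.re - 1) * Real.exp (-(r * y)) := by
  rw [norm_mul, norm_cpow_eq_rpow_re_of_pos hy, Complex.norm_exp]
  simp

lemma integrableOn_cpow_mul_exp_neg_mul {s : ℂ} {r : ℝ} (hs : 0 < s.re) (hr : 0 < r) :
    IntegrableOn (fun y : ℝ ↦ (y : ℂ) ^ (s - 1) * Complex.exp (-(r * y))) (Ioi 0) := by
  have h := integrableOn_rpow_mul_exp_neg_mul_rpow (s := s.re - 1) (by linarith) one_pos hr
  refine Integrable.mono' h (by fun_prop) ?_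
  filter_upwards [ae_restrict_mem measurableSet_Ioi] with y hy
  rw [norm_cpow_mul_exp_neg_mul hy, Real.rpow_one, neg_mul]

lemma one_div_two_pi_mul_cosh_cpow (s : ℂ) (t : ℝ) :
    (1 / ((2 * Real.pi * Real.cosh t : ℝ) : ℂ)) ^ s =
      (Real.pi : ℂ) ^ (-s) * ((2 * Real.cosh t : ℝ) : ℂ) ^ (-s) := by
  have hc : 0 < 2 * Real.cosh t := mul_pos two_pos (Real.cosh_pos t)
  rw [← mul_cpow_ofReal_nonneg Real.pi_pos.le hc.le, ← ofReal_mul, one_div, inv_cpow, ← cpow_neg]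
  · congr 2
    ring
  · rw [arg_ofReal_of_nonneg (by positivity)]
    exact Real.pi_pos.ne

lemma integrable_bessel_kernel {u v : ℂ} (hu : 0 < u.re) (hv : 0 < v.re) :
    Integrable (Function.uncurry fun y t : ℝ ↦
      ((y : ℂ) ^ (u + v - 1) * Complex.exp (-((2 * Real.pi * Real.cosh t : ℝ) * y))) *
        Complex.cosh ((u - v) * t))
      ((volume.restrict (Ioi 0)).prod (volume.restrict (Ioi 0))) := by
  have hs : 0 < (u + v).re := by simpa using add_pos hu hv
  have hr (t : ℝ) : 0 < 2 * Real.pi * Real.cosh t :=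
    mul_pos Real.two_pi_pos (Real.cosh_pos t)
  rw [integrable_prod_iff' (by unfold Function.uncurry; fun_prop)]
  refine ⟨.of_forall fun t ↦
    (integrableOn_cpow_mul_exp_neg_mul hs (hr t)).mul_const (Complex.cosh ((u - v) * t)), ?_⟩
  convert (integrableOn_cosh_mul_cosh_cpow hu hv).norm.const_mul
    (‖(Real.pi : ℂ) ^ (-(u + v))‖ * Real.Gamma (u + v).re) using 2 with t
  have hn : ‖(1 / ((2 * Real.pi * Real.cosh t : ℝ) : ℂ)) ^ (u + v)‖ =
      (1 / (2 * Real.pi * Real.cosh t)) ^ (u + v).re := by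
    rw [← ofReal_one, ← ofReal_div, norm_cpow_eq_rpow_re_of_pos (one_div_pos.mpr (hr t))]
  simp only [Function.uncurry_apply_pair, norm_mul (_ * _) (Complex.cosh _)]
  rw [integral_mul_const, setIntegral_congr_fun measurableSet_Ioi
    fun y hy ↦ norm_cpow_mul_exp_neg_mul hy, Real.integral_rpow_mul_exp_neg_mul_Ioi hs (hr t), ← hn,
    one_div_two_pi_mul_cosh_cpow, norm_mul, norm_mul]
  ring

lemma W2_mul_cpow (μ w : ℂ) {y : ℝ} (hy : 0 < y) :
    W2 μ y * (y : ℂ) ^ (w - 1) =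
      2 * ∫ t in Ioi (0 : ℝ), ((y : ℂ) ^ (w + 1 / 2 - 1) *
        Complex.exp (-((2 * Real.pi * Real.cosh t : ℝ) * y))) * Complex.cosh (μ * t) := by
  have hy' : (y : ℂ) ≠ 0 := ofReal_ne_zero.mpr hy.ne'
  have hsqrt : (Real.sqrt y : ℂ) * (y : ℂ) ^ (w - 1) = (y : ℂ) ^ (w + 1 / 2 - 1) := by
    rw [Real.sqrt_eq_rpow, ofReal_cpow hy.le, ← cpow_add _ _ hy']
    congr 1
    push_cast
    ring
  simp_rw [mul_assoc ((y : ℂ) ^ (w + 1 / 2 - 1))]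
  rw [integral_const_mul, ← hsqrt, W2, KBessel]
  have hexp (t : ℝ) : -((2 * Real.pi * y : ℝ) : ℂ) * (Real.cosh t : ℂ) =
      -((2 * Real.pi * Real.cosh t : ℝ) * y) := by
    push_cast
    ring
  simp_rw [hexp]
  ring

/-- Mellin transform of the GL(2) Whittaker function. -/
theorem mellin_whittaker_gl2 (μ w : ℂ)
    (h₁ : 0 < (w + 1/2 + μ).re) (h₂ : 0 < (w + 1/2 - μ).re) :
    ∫ y in Ioi (0:ℝ), W2 μ y * (y : ℂ) ^ (w - 1) =
      ((Real.pi : ℂ) ^ (-w - 1/2) / 2) *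
        Complex.Gamma ((w + 1/2 + μ) / 2) * Complex.Gamma ((w + 1/2 - μ) / 2) := by
  rw [setIntegral_congr_fun measurableSet_Ioi fun y hy ↦ W2_mul_cpow μ w hy, integral_const_mul]
  set u := (w + 1/2 + μ) / 2 with hu_def
  set v := (w + 1/2 - μ) / 2 with hv_def
  have hu : 0 < u.re := by
    rw [hu_def, div_ofNat_re]
    exact half_pos h₁
  have hv : 0 < v.re := by
    rw [hv_def, div_ofNat_re]
    exact half_pos h₂
  have hs : w + 1 / 2 = u + v := by ring
  have hμ : μ = u - v := by ring
  have hpi : -w - 1 / 2 = -(u + v) := by rw [← hs]; ring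
  rw [hs, hpi, mul_assoc, Gamma_mul_Gamma_eq_betaIntegral hu hv]
  clear_value u v
  subst hμ
  rw [integral_integral_swap (integrable_bessel_kernel hu hv)]
  have hinner (t : ℝ) : ∫ y in Ioi (0 : ℝ), ((y : ℂ) ^ (u + v - 1) *
        Complex.exp (-((2 * Real.pi * Real.cosh t : ℝ) * y))) * Complex.cosh ((u - v) * t) =
      (Real.pi : ℂ) ^ (-(u + v)) * Gamma (u + v) *
        (Complex.cosh ((u - v) * t) * ((2 * Real.cosh t : ℝ) : ℂ) ^ (-(u + v))) := by
    rw [integral_mul_const, integral_cpow_mul_exp_neg_mul_Ioi (by simpa using add_pos hu hv)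
      (mul_pos Real.two_pi_pos (Real.cosh_pos t)), one_div_two_pi_mul_cosh_cpow]
    ring
  simp_rw [hinner]
  rw [integral_const_mul, integral_cosh_mul_cosh_cpow hu hv]
  ring
end

section
/- Kontorovich–Lebedev bound: Fix η > 40 and let H ∈ C_η. Then for every y > 0 the integrand t ↦ H(it)·W_{it}(y)/(Γ(it)Γ(−it)) is integrable on ℝ, so that H^♭(y) is well defined, and there exists a constant C > 0 such that |H^♭(y)| ≤ C · min(y, y^{−1})^η for all y > 0. -/
open Complex MeasureTheory Set

/-- The class `C_η` of test functions: holomorphic on `|Re μ| < 2η`, even, and with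
rapid decay `|H(μ)| ≤ C exp(−2π|Im μ|)` on the strip. -/
def MemCeta (η : ℝ) (H : ℂ → ℂ) : Prop :=
  DifferentiableOn ℂ H {μ : ℂ | |μ.re| < 2 * η} ∧
  (∀ μ : ℂ, |μ.re| < 2 * η → H (-μ) = H μ) ∧
  ∃ C : ℝ, ∀ μ : ℂ, |μ.re| < 2 * η → ‖H μ‖ ≤ C * Real.exp (-2 * Real.pi * |μ.im|)

/-- The inverse Kontorovich–Lebedev transform
`H^♭(y) := (1/(4π)) ∫_ℝ H(it) W_{it}(y) / (Γ(it)Γ(−it)) dt`. -/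
noncomputable def Hflat (H : ℂ → ℂ) (y : ℝ) : ℂ :=
  (1 / (4 * (Real.pi : ℂ))) * ∫ t : ℝ,
    H (t * I) * W2 (t * I) y / (Complex.Gamma (t * I) * Complex.Gamma (-(t * I)))

open Filter Topology FourierTransform

section Strip

/-- `exp (-c |t|)` is integrable on the real line for `c > 0`. -/
lemma integrable_exp_neg_mul_abs {c : ℝ} (hc : 0 < c) :
    Integrable (fun t : ℝ => Real.exp (-c * |t|)) := by
  have hpos : IntegrableOn (fun t : ℝ => Real.exp (-c * |t|)) (Ioi 0) :=
    (exp_neg_integrableOn_Ioi 0 hc).congr_fun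
      (fun t ht => by simp only [abs_of_pos (mem_Ioi.1 ht)]) measurableSet_Ioi
  have hneg : IntegrableOn (fun t : ℝ => Real.exp (-c * |t|)) (Iic 0) := by
    rw [integrableOn_Iic_iff_integrableOn_Iio]
    have := (neg_zero (G := ℝ) ▸ hpos : IntegrableOn _ (Ioi (-(0 : ℝ)))).comp_neg_Iio
    simpa only [abs_neg] using this
  rw [← integrableOn_univ, ← Iic_union_Ioi (a := (0 : ℝ))]
  exact hneg.union hpos

variable {F : ℂ → ℂ} {R C : ℝ}

lemma continuous_verticalLine (hF : DifferentiableOn ℂ F {μ : ℂ | |μ.re| < R}) {σ : ℝ}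
    (hσ : |σ| < R) : Continuous (fun t : ℝ => F (σ + t * I)) :=
  hF.continuousOn.comp_continuous (by fun_prop) (fun t => by simpa using hσ)

lemma integrable_verticalLine (hF : DifferentiableOn ℂ F {μ : ℂ | |μ.re| < R})
    (hb : ∀ μ : ℂ, |μ.re| < R → ‖F μ‖ ≤ C * Real.exp (-|μ.im|)) {σ : ℝ} (hσ : |σ| < R) :
    Integrable (fun t : ℝ => F (σ + t * I)) := by
  refine ((integrable_exp_neg_mul_abs one_pos).const_mul C).mono'
    (continuous_verticalLine hF hσ).aestronglyMeasurable (Eventually.of_forall fun t => ?_)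
  simpa using hb (σ + t * I) (by simpa using hσ)

/-- Contour shift between vertical lines in a strip of holomorphy. -/
lemma integral_verticalLine_eq (hF : DifferentiableOn ℂ F {μ : ℂ | |μ.re| < R})
    (hb : ∀ μ : ℂ, |μ.re| < R → ‖F μ‖ ≤ C * Real.exp (-|μ.im|)) {σ : ℝ} (hσ : |σ| < R) :
    ∫ t : ℝ, F (t * I) = ∫ t : ℝ, F (σ + t * I) := by
  have hR : |(0 : ℝ)| < R := by simpa using (abs_nonneg σ).trans_lt hσ
  have hmem : ∀ x ∈ uIcc 0 σ, |x| < R := fun x hx => by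
    have := abs_sub_left_of_mem_uIcc hx
    simp only [sub_zero] at this
    exact this.trans_lt hσ
  have hrect : ∀ T : ℝ, I • ((∫ t in (-T)..T, F (σ + t * I)) - ∫ t in (-T)..T, F (t * I)) =
      (∫ x in (0 : ℝ)..σ, F (x + T * I)) - ∫ x in (0 : ℝ)..σ, F (x + (-T : ℝ) * I) := by
    intro T
    have h := integral_boundary_rect_eq_zero_of_differentiableOn F
      (⟨0, -T⟩ : ℂ) (⟨σ, T⟩ : ℂ) (hF.mono fun z hz => hmem _ hz.1)
    simp only [ofReal_zero, zero_add] at h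
    rw [smul_sub]
    linear_combination h
  have hhor : ∀ ε : ℝ, |ε| = 1 →
      Tendsto (fun T : ℝ => ∫ x in (0 : ℝ)..σ, F (x + (ε * T : ℝ) * I)) atTop (𝓝 0) := by
    intro ε hε
    have hlim : Tendsto (fun T : ℝ => C * Real.exp (-T) * |σ - 0|) atTop (𝓝 0) := by
      simpa using (Real.tendsto_exp_neg_atTop_nhds_zero.const_mul C).mul_const |σ - 0|
    refine squeeze_zero_norm' ?_ hlim
    filter_upwards [eventually_ge_atTop 0] with T hT
    refine intervalIntegral.norm_integral_le_of_norm_le_const fun x hx => ?_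
    have := hb (x + (ε * T : ℝ) * I) (by simpa using hmem x (uIoc_subset_uIcc hx))
    simpa [abs_mul, hε, abs_of_nonneg hT] using this
  have hlim : ∀ s : ℝ, |s| < R →
      Tendsto (fun T : ℝ => ∫ t in (-T)..T, F (s + t * I)) atTop (𝓝 (∫ t : ℝ, F (s + t * I))) :=
    fun s hs => intervalIntegral_tendsto_integral (integrable_verticalLine hF hb hs)
      tendsto_neg_atTop_atBot tendsto_id
  have h0 := hlim 0 hR
  simp only [ofReal_zero, zero_add] at h0
  have hl := ((hlim σ hσ).sub h0).const_smul I
  have hr := (hhor 1 (by simp)).sub (hhor (-1) (by simp))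
  simp only [one_mul, neg_mul, sub_zero] at hr
  simp only [hrect] at hl
  have := tendsto_nhds_unique hl hr
  rw [smul_eq_zero, sub_eq_zero] at this
  exact (this.resolve_left I_ne_zero).symm

/-- The transform `u ↦ ∫ F(it) e^{itu} dt` of a function on the imaginary axis. -/
noncomputable def axisFourier (F : ℂ → ℂ) (u : ℝ) : ℂ :=
  ∫ t : ℝ, F (t * I) * Complex.exp (t * I * u)

lemma axisFourier_eq_exp_mul (hF : DifferentiableOn ℂ F {μ : ℂ | |μ.re| < R})
    (hb : ∀ μ : ℂ, |μ.re| < R → ‖F μ‖ ≤ C * Real.exp (-|μ.im|)) {σ : ℝ} (hσ : |σ| < R)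
    (u : ℝ) :
    axisFourier F u =
      Complex.exp (σ * u) * ∫ t : ℝ, F (σ + t * I) * Complex.exp (t * I * u) := by
  have hC : 0 ≤ C := by
    have := (norm_nonneg _).trans (hb σ (by simpa using hσ))
    simpa using this
  have hd : DifferentiableOn ℂ (fun μ => F μ * Complex.exp (μ * u)) {μ : ℂ | |μ.re| < R} :=
    hF.mul (by fun_prop)
  have := integral_verticalLine_eq hd (C := C * Real.exp (R * |u|)) ?_ hσ
  · rw [axisFourier, this, ← integral_const_mul]
    refine integral_congr_ae (Eventually.of_forall fun t => ?_)
    simp only [add_mul, Complex.exp_add]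
    ring
  · intro μ hμ
    rw [norm_mul, Complex.norm_exp]
    have h1 : (μ * u).re ≤ R * |u| := by
      simp only [mul_re, ofReal_re, ofReal_im, mul_zero, sub_zero]
      calc μ.re * u ≤ |μ.re * u| := le_abs_self _
        _ = |μ.re| * |u| := abs_mul _ _
        _ ≤ R * |u| := by gcongr
    calc ‖F μ‖ * Real.exp (μ * u).re
        ≤ (C * Real.exp (-|μ.im|)) * Real.exp (R * |u|) := by
          gcongr
          exact hb μ hμ
      _ = _ := by ring

lemma norm_axisFourier_le (hF : DifferentiableOn ℂ F {μ : ℂ | |μ.re| < R})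
    (hb : ∀ μ : ℂ, |μ.re| < R → ‖F μ‖ ≤ C * Real.exp (-|μ.im|)) {σ : ℝ} (hσ0 : 0 ≤ σ)
    (hσ : σ < R) (u : ℝ) :
    ‖axisFourier F u‖ ≤ (C * ∫ t : ℝ, Real.exp (-1 * |t|)) * Real.exp (-σ * |u|) := by
  have key : ∀ s : ℝ, |s| < R →
      ‖axisFourier F u‖ ≤ (C * ∫ t : ℝ, Real.exp (-1 * |t|)) * Real.exp (s * u) := by
    intro s hs
    rw [axisFourier_eq_exp_mul hF hb hs, norm_mul, Complex.norm_exp, mul_comm]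
    have h1 : ((s : ℂ) * u).re = s * u := by simp
    rw [h1, ← integral_const_mul]
    gcongr
    refine norm_integral_le_of_norm_le ((integrable_exp_neg_mul_abs one_pos).const_mul C)
      (Eventually.of_forall fun t => ?_)
    rw [norm_mul, Complex.norm_exp]
    simpa using hb (s + t * I) (by simpa using hs)
  rcases le_total 0 u with hu | hu
  · have := key (-σ) (by rwa [abs_neg, abs_of_nonneg hσ0])
    rwa [abs_of_nonneg hu]
  · have := key σ (by rwa [abs_of_nonneg hσ0])
    rwa [abs_of_nonpos hu, neg_mul_neg]

lemma continuous_axisFourier (hF : DifferentiableOn ℂ F {μ : ℂ | |μ.re| < R})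
    (hb : ∀ μ : ℂ, |μ.re| < R → ‖F μ‖ ≤ C * Real.exp (-|μ.im|)) (hR : 0 < R) :
    Continuous (axisFourier F) := by
  have hR' : |(0 : ℝ)| < R := by simpa using hR
  have hi := integrable_verticalLine hF hb hR'
  have hc := continuous_verticalLine hF hR'
  simp only [ofReal_zero, zero_add] at hi hc
  refine continuous_of_dominated (bound := fun t : ℝ => ‖F (t * I)‖) (fun u => ?_)
    (fun u => Eventually.of_forall fun t => ?_) hi.norm
    (Eventually.of_forall fun t => by fun_prop)
  · exact (hc.mul (by fun_prop)).aestronglyMeasurable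
  · simp [Complex.norm_exp]

/-- A continuous function dominated by `exp (k |u|)` is integrable against `axisFourier F`. -/
lemma integrable_mul_axisFourier (hF : DifferentiableOn ℂ F {μ : ℂ | |μ.re| < R})
    (hb : ∀ μ : ℂ, |μ.re| < R → ‖F μ‖ ≤ C * Real.exp (-|μ.im|)) {k : ℝ} (hk0 : 0 ≤ k)
    (hk : k < R) {f : ℝ → ℂ} (hf : Continuous f) (hfb : ∀ u, ‖f u‖ ≤ Real.exp (k * |u|)) :
    Integrable (fun u : ℝ => f u * axisFourier F u) := by
  obtain ⟨σ, hkσ, hσR⟩ := exists_between hk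
  refine ((integrable_exp_neg_mul_abs (sub_pos.2 hkσ)).const_mul
    (C * ∫ t : ℝ, Real.exp (-1 * |t|))).mono'
    (hf.mul (continuous_axisFourier hF hb (hk0.trans_lt hk))).aestronglyMeasurable
    (Eventually.of_forall fun u => ?_)
  rw [norm_mul]
  calc ‖f u‖ * ‖axisFourier F u‖
      ≤ Real.exp (k * |u|) *
          ((C * ∫ t : ℝ, Real.exp (-1 * |t|)) * Real.exp (-σ * |u|)) := by
        gcongr
        · exact hfb u
        · exact norm_axisFourier_le hF hb (hk0.trans hkσ.le) hσR u
    _ = (C * ∫ t : ℝ, Real.exp (-1 * |t|)) * (Real.exp (k * |u|) * Real.exp (-σ * |u|)) := by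
        ring
    _ = _ := by rw [← Real.exp_add]; ring_nf

/-- Zeros of `F` on the real axis are vanishing exponential moments of `axisFourier F`. -/
lemma integral_exp_mul_axisFourier (hF : DifferentiableOn ℂ F {μ : ℂ | |μ.re| < R})
    (hb : ∀ μ : ℂ, |μ.re| < R → ‖F μ‖ ≤ C * Real.exp (-|μ.im|)) {j : ℝ} (hj : |j| < R)
    (h0 : F (-j : ℝ) = 0) :
    ∫ u : ℝ, Complex.exp (j * u) * axisFourier F u = 0 := by
  have hj' : |(-j)| < R := by rwa [abs_neg]
  have hint : Integrable (fun u : ℝ => Complex.exp (j * u) * axisFourier F u) := by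
    refine integrable_mul_axisFourier hF hb (abs_nonneg j) hj (by fun_prop) fun u => ?_
    rw [Complex.norm_exp, Real.exp_le_exp, ← abs_mul]
    simpa using le_abs_self (j * u)
  have hfour : 𝓕 (fun t : ℝ => F ((-j : ℝ) + t * I)) = fun w : ℝ =>
      Complex.exp (j * ((-2 * Real.pi) * w : ℝ)) * axisFourier F ((-2 * Real.pi) * w) := by
    ext w
    rw [Real.fourier_real_eq_integral_exp_smul, axisFourier_eq_exp_mul hF hb hj', ← mul_assoc,
      ← Complex.exp_add]
    have : (j : ℂ) * ((-2 * Real.pi) * w : ℝ) + ((-j : ℝ) : ℂ) * ((-2 * Real.pi) * w : ℝ) = 0 := by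
      push_cast; ring
    rw [this, Complex.exp_zero, one_mul]
    refine integral_congr_ae (Eventually.of_forall fun t => ?_)
    simp only [smul_eq_mul]
    rw [mul_comm]
    congr 2
    push_cast; ring
  have hpi : (-2 * Real.pi) ≠ 0 := mul_ne_zero (by norm_num) Real.pi_ne_zero
  have hinv := (continuous_verticalLine hF hj').fourierInv_fourier_eq
    (integrable_verticalLine hF hb hj') (by rw [hfour]; exact hint.comp_mul_left' hpi)
  have h1 := congrFun hinv 0
  rw [hfour, Real.fourierInv_eq'] at h1
  simp only [inner_zero_right, mul_zero, ofReal_zero, zero_mul, Complex.exp_zero, one_smul,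
    add_zero, h0] at h1
  rw [Measure.integral_comp_mul_left
    (fun u : ℝ => Complex.exp (j * u) * axisFourier F u) (-2 * Real.pi)] at h1
  exact (smul_eq_zero.1 h1).resolve_left (by simp)

lemma cosh_le_exp_abs (u : ℝ) : Real.cosh u ≤ Real.exp |u| := by
  rw [← Real.cosh_abs, Real.cosh_eq]
  have : Real.exp (-|u|) ≤ Real.exp |u| := Real.exp_le_exp.2 (neg_le_self (abs_nonneg u))
  linarith

lemma norm_exp_mul_cosh_pow_le (j : ℤ) (k : ℕ) (u : ℝ) :
    ‖Complex.exp ((j : ℝ) * u) * (Real.cosh u : ℂ) ^ k‖ ≤ Real.exp ((|(j : ℝ)| + k) * |u|) := by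
  rw [norm_mul, norm_pow, Complex.norm_exp, Complex.norm_real, Real.norm_of_nonneg (Real.cosh_pos u).le,
    add_mul, Real.exp_add, Real.exp_nat_mul]
  gcongr
  · rw [← abs_mul]
    simpa using le_abs_self ((j : ℝ) * u)
  · exact cosh_le_exp_abs u

/-- If `F` vanishes at the integers, then `axisFourier F` is orthogonal to `e^{ju} cosh^k u`. -/
lemma integral_exp_mul_cosh_pow_mul_axisFourier
    (hF : DifferentiableOn ℂ F {μ : ℂ | |μ.re| < R})
    (hb : ∀ μ : ℂ, |μ.re| < R → ‖F μ‖ ≤ C * Real.exp (-|μ.im|))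
    (hz : ∀ n : ℤ, F ((n : ℝ) : ℂ) = 0) (k : ℕ) :
    ∀ j : ℤ, |(j : ℝ)| + k < R →
      ∫ u : ℝ, Complex.exp ((j : ℝ) * u) * (Real.cosh u : ℂ) ^ k * axisFourier F u = 0 := by
  induction k with
  | zero =>
    intro j hj
    simp only [pow_zero, mul_one]
    refine integral_exp_mul_axisFourier hF hb (by simpa using hj) ?_
    simpa using hz (-j)
  | succ k ih =>
    intro j hj
    push_cast at hj
    have hadd : ∀ e : ℤ, |(e : ℝ)| = 1 → |((j + e : ℤ) : ℝ)| + k < R := fun e he => by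
      have := abs_add_le (j : ℝ) e
      push_cast
      linarith
    have hint : ∀ e : ℤ, |(e : ℝ)| = 1 → Integrable fun u : ℝ =>
        Complex.exp (((j + e : ℤ) : ℝ) * u) * (Real.cosh u : ℂ) ^ k * axisFourier F u :=
      fun e he => integrable_mul_axisFourier hF hb (by positivity) (hadd e he)
        (by fun_prop) (norm_exp_mul_cosh_pow_le _ k)
    have h1 : |((1 : ℤ) : ℝ)| = 1 := by simp
    have h2 : |((-1 : ℤ) : ℝ)| = 1 := by simp
    have hsplit : ∀ u : ℝ,
        Complex.exp ((j : ℝ) * u) * (Real.cosh u : ℂ) ^ (k + 1) * axisFourier F u =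
        (1 / 2) * (Complex.exp (((j + 1 : ℤ) : ℝ) * u) * (Real.cosh u : ℂ) ^ k *
          axisFourier F u + Complex.exp (((j + -1 : ℤ) : ℝ) * u) * (Real.cosh u : ℂ) ^ k *
          axisFourier F u) := by
      intro u
      have e1 : ((((j + 1 : ℤ) : ℝ) : ℂ) * u) = (j : ℝ) * u + u := by push_cast; ring
      have e2 : ((((j + -1 : ℤ) : ℝ) : ℂ) * u) = (j : ℝ) * u + -u := by push_cast; ring
      rw [e1, e2, Complex.exp_add, Complex.exp_add, pow_succ]
      have hc : (Real.cosh u : ℂ) = (Complex.exp u + Complex.exp (-u)) / 2 := by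
        rw [Complex.ofReal_cosh, Complex.cosh]
      linear_combination (Complex.exp ((j : ℝ) * u) * (Real.cosh u : ℂ) ^ k *
        axisFourier F u) * hc
    simp_rw [hsplit]
    rw [integral_const_mul, integral_add (hint 1 h1) (hint (-1) h2), ih _ (hadd 1 h1),
      ih _ (hadd (-1) h2)]
    simp

/-- Taylor remainder of `e^{-z}`, uniformly in `z ≥ 0`. -/
lemma norm_exp_neg_sub_sum_le {z : ℝ} (hz : 0 ≤ z) (N : ℕ) :
    ‖Complex.exp (-z) - ∑ m ∈ Finset.range N, (-z : ℂ) ^ m / m.factorial‖ ≤ (N + 3) * z ^ N := by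
  rcases le_total z 1 with h | h
  · refine (norm_exp_sub_sum_le_norm_mul_exp _ N).trans ?_
    rw [norm_neg, Complex.norm_real, Real.norm_of_nonneg hz, mul_comm]
    gcongr
    have := Real.exp_le_exp.2 h
    have := Real.exp_one_lt_d9
    have : (0 : ℝ) ≤ N := N.cast_nonneg
    linarith
  · have hexp : ‖Complex.exp (-z)‖ ≤ z ^ N := by
      rw [Complex.norm_exp]
      refine le_trans ?_ (one_le_pow₀ h)
      simpa using hz
    have hsum : ‖∑ m ∈ Finset.range N, (-z : ℂ) ^ m / m.factorial‖ ≤ N * z ^ N := by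
      have : ∀ m ∈ Finset.range N, ‖(-z : ℂ) ^ m / m.factorial‖ ≤ z ^ N := fun m hm => by
        rw [norm_div, norm_pow, norm_neg, Complex.norm_real, Real.norm_of_nonneg hz,
          Complex.norm_natCast]
        calc z ^ m / m.factorial ≤ z ^ m :=
              div_le_self (by positivity) (by exact_mod_cast m.factorial_pos)
          _ ≤ z ^ N := pow_le_pow_right₀ h (Finset.mem_range.1 hm).le
      simpa using norm_sum_le_of_le _ this
    have := norm_sub_le (Complex.exp (-z)) (∑ m ∈ Finset.range N, (-z : ℂ) ^ m / m.factorial)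
    have : 0 ≤ z ^ N := by positivity
    nlinarith

lemma norm_integral_exp_neg_cosh_mul_axisFourier_le_pow
    (hF : DifferentiableOn ℂ F {μ : ℂ | |μ.re| < R})
    (hb : ∀ μ : ℂ, |μ.re| < R → ‖F μ‖ ≤ C * Real.exp (-|μ.im|))
    (hz : ∀ n : ℤ, F ((n : ℝ) : ℂ) = 0) {N : ℕ} (hN : N < R) {x : ℝ} (hx : 0 < x) :
    ‖∫ u : ℝ, Complex.exp (-(x : ℂ) * (Real.cosh u : ℂ)) * axisFourier F u‖ ≤
      ((N + 3) * ∫ u : ℝ, ‖(Real.cosh u : ℂ) ^ N * axisFourier F u‖) * x ^ N := by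
  have hbd : ∀ (m : ℕ) (u : ℝ), ‖(Real.cosh u : ℂ) ^ m‖ ≤ Real.exp (m * |u|) := fun m u => by
    simpa using norm_exp_mul_cosh_pow_le 0 m u
  have hint : ∀ m : ℕ, m ≤ N →
      Integrable fun u : ℝ => (Real.cosh u : ℂ) ^ m * axisFourier F u := fun m hm =>
    integrable_mul_axisFourier hF hb (Nat.cast_nonneg m)
      ((Nat.cast_le.2 hm).trans_lt hN) (by fun_prop) (hbd m)
  have hexp : Integrable fun u : ℝ =>
      Complex.exp (-(x : ℂ) * (Real.cosh u : ℂ)) * axisFourier F u := by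
    refine integrable_mul_axisFourier hF hb le_rfl ((Nat.cast_nonneg N).trans_lt hN)
      (by fun_prop) fun u => ?_
    rw [Complex.norm_exp, zero_mul, Real.exp_le_exp, neg_mul, neg_re, re_ofReal_mul, ofReal_re]
    have := mul_pos hx (Real.cosh_pos u)
    linarith
  have hterm : ∀ m ∈ Finset.range N, Integrable fun u : ℝ =>
      ((-x : ℂ) ^ m / m.factorial) * ((Real.cosh u : ℂ) ^ m * axisFourier F u) := fun m hm =>
    (hint m (Finset.mem_range.1 hm).le).const_mul _
  have hsum : ∫ u : ℝ, ∑ m ∈ Finset.range N,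
      ((-x : ℂ) ^ m / m.factorial) * ((Real.cosh u : ℂ) ^ m * axisFourier F u) = 0 := by
    rw [integral_finsetSum _ hterm]
    refine Finset.sum_eq_zero fun m hm => ?_
    have h := integral_exp_mul_cosh_pow_mul_axisFourier hF hb hz m 0
      (by simpa using (Nat.cast_lt.2 (Finset.mem_range.1 hm)).trans hN)
    simp only [Int.cast_zero, ofReal_zero, zero_mul, Complex.exp_zero, one_mul] at h
    rw [integral_const_mul, h, mul_zero]
  rw [← sub_zero (∫ u : ℝ, Complex.exp (-(x : ℂ) * (Real.cosh u : ℂ)) * axisFourier F u), ← hsum,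
    ← integral_sub hexp (integrable_finsetSum _ hterm), mul_right_comm, ← integral_const_mul]
  refine norm_integral_le_of_norm_le ((hint N le_rfl).norm.const_mul _)
    (Eventually.of_forall fun u => ?_)
  have hc := (Real.cosh_pos u).le
  have ht := norm_exp_neg_sub_sum_le (mul_nonneg hx.le hc) N
  have heq : Complex.exp (-(x : ℂ) * (Real.cosh u : ℂ)) * axisFourier F u -
      ∑ m ∈ Finset.range N,
        ((-x : ℂ) ^ m / m.factorial) * ((Real.cosh u : ℂ) ^ m * axisFourier F u) =
      (Complex.exp (-(x * Real.cosh u : ℝ)) - ∑ m ∈ Finset.range N,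
        (-(x * Real.cosh u : ℝ) : ℂ) ^ m / m.factorial) * axisFourier F u := by
    rw [sub_mul, Finset.sum_mul, ofReal_mul, neg_mul]
    congr 1
    refine Finset.sum_congr rfl fun m _ => ?_
    rw [← neg_mul, mul_pow]
    ring
  rw [heq, norm_mul, norm_mul, norm_pow, Complex.norm_real, Real.norm_of_nonneg hc]
  calc _ ≤ ((N + 3) * (x * Real.cosh u) ^ N) * ‖axisFourier F u‖ := by gcongr
    _ = _ := by rw [mul_pow]; ring

lemma norm_integral_exp_neg_cosh_mul_axisFourier_le_inv_pow
    (hF : DifferentiableOn ℂ F {μ : ℂ | |μ.re| < R})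
    (hb : ∀ μ : ℂ, |μ.re| < R → ‖F μ‖ ≤ C * Real.exp (-|μ.im|)) (hR : 0 < R) (N : ℕ) {x : ℝ}
    (hx : 0 < x) :
    ‖∫ u : ℝ, Complex.exp (-(x : ℂ) * (Real.cosh u : ℂ)) * axisFourier F u‖ ≤
      (N.factorial * ∫ u : ℝ, ‖axisFourier F u‖) * (x ^ N)⁻¹ := by
  have hint : Integrable (axisFourier F) := by
    simpa using integrable_mul_axisFourier hF hb le_rfl hR
      (continuous_const (y := (1 : ℂ))) (fun u => by simp)
  rw [mul_right_comm, ← integral_const_mul]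
  refine norm_integral_le_of_norm_le (hint.norm.const_mul _) (Eventually.of_forall fun u => ?_)
  rw [norm_mul]
  gcongr
  rw [Complex.norm_exp, neg_mul, neg_re, re_ofReal_mul, ofReal_re, Real.exp_neg,
    ← div_eq_mul_inv, ← inv_div]
  gcongr
  refine (Real.pow_div_factorial_le_exp x hx.le N).trans (Real.exp_le_exp.2 ?_)
  exact le_mul_of_one_le_right hx.le (Real.one_le_cosh u)

end Strip

lemma inv_Gamma_mul_Gamma_neg (z : ℂ) :
    (Complex.Gamma z * Complex.Gamma (-z))⁻¹ = -(z * Complex.sin (Real.pi * z)) / Real.pi := by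
  rcases eq_or_ne z 0 with rfl | hz
  · simp [Complex.Gamma_zero]
  · have h1 := Complex.Gamma_mul_Gamma_one_sub z
    have h2 := Complex.Gamma_add_one (-z) (neg_ne_zero.2 hz)
    rw [neg_add_eq_sub] at h2
    have h3 : Complex.Gamma z * Complex.Gamma (-z) =
        (Real.pi / Complex.sin (Real.pi * z)) / -z := by
      rw [← h1, h2]
      field_simp
    rw [h3, inv_div, div_div_eq_mul_div]
    ring

lemma integrable_exp_neg_mul_cosh {x : ℝ} (hx : 0 < x) :
    Integrable (fun u : ℝ => Complex.exp (-(x : ℂ) * (Real.cosh u : ℂ))) := by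
  refine (integrable_exp_neg_mul_abs (half_pos hx)).mono'
    (by fun_prop : Continuous _).aestronglyMeasurable (Eventually.of_forall fun u => ?_)
  rw [Complex.norm_exp, Real.exp_le_exp, neg_mul, neg_re, re_ofReal_mul, ofReal_re, neg_mul,
    neg_le_neg_iff, ← Real.cosh_abs, Real.cosh_eq]
  have h1 := Real.add_one_le_exp |u|
  have h2 := Real.exp_pos (-|u|)
  have : |u| / 2 ≤ (Real.exp |u| + Real.exp (-|u|)) / 2 := by linarith
  nlinarith

/-- On the imaginary axis `K_{it}(x)` is half of a two-sided Fourier integral. -/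
lemma KBessel_mul_I (t : ℝ) {x : ℝ} (hx : 0 < x) :
    KBessel (t * I) x = (1 / 2) * ∫ u : ℝ,
      Complex.exp (-(x : ℂ) * (Real.cosh u : ℂ)) * Complex.exp (t * I * u) := by
  have hint : ∀ s : ℝ, Integrable fun u : ℝ =>
      Complex.exp (-(x : ℂ) * (Real.cosh u : ℂ)) * Complex.exp (s * I * u) := fun s =>
    (integrable_exp_neg_mul_cosh hx).mul_bdd (c := 1)
      (by fun_prop : Continuous _).aestronglyMeasurable
      (Eventually.of_forall fun u => by simp [Complex.norm_exp])
  rw [← intervalIntegral.integral_Iic_add_Ioi (b := 0) (hint t).integrableOn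
    (hint t).integrableOn]
  have hneg := integral_comp_neg_Ioi (0 : ℝ) (fun u : ℝ =>
    Complex.exp (-(x : ℂ) * (Real.cosh u : ℂ)) * Complex.exp (t * I * u))
  rw [neg_zero] at hneg
  rw [← hneg, ← integral_add, KBessel, ← integral_const_mul]
  · refine integral_congr_ae (Eventually.of_forall fun u => ?_)
    simp only [Real.cosh_neg, Complex.cosh, ofReal_neg, mul_neg]
    ring
  · refine (hint (-t)).integrableOn.congr_fun (fun u _ => ?_) measurableSet_Ioi
    simp
  · exact (hint t).integrableOn

/-- The product of `H` with the spectral density `1/(Γ(μ)Γ(−μ)) = −μ sin(πμ)/π`. -/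
noncomputable def spectralWeight (H : ℂ → ℂ) (μ : ℂ) : ℂ :=
  H μ * (-(μ * Complex.sin (Real.pi * μ)) / Real.pi)

lemma spectralWeight_int (H : ℂ → ℂ) (n : ℤ) : spectralWeight H ((n : ℝ) : ℂ) = 0 := by
  simp [spectralWeight, mul_comm (Real.pi : ℂ), Complex.sin_int_mul_pi]

lemma norm_sin_le_exp_abs_im (z : ℂ) : ‖Complex.sin z‖ ≤ Real.exp |z.im| := by
  have h1 : ‖Complex.exp (-z * I)‖ ≤ Real.exp |z.im| := by
    rw [Complex.norm_exp, Real.exp_le_exp]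
    simpa using le_abs_self z.im
  have h2 : ‖Complex.exp (z * I)‖ ≤ Real.exp |z.im| := by
    rw [Complex.norm_exp, Real.exp_le_exp]
    simpa using neg_le_abs z.im
  rw [Complex.sin, norm_div, norm_mul, norm_I, mul_one, Complex.norm_ofNat]
  have := norm_sub_le (Complex.exp (-z * I)) (Complex.exp (z * I))
  linarith

lemma MemCeta.differentiableOn_spectralWeight {η : ℝ} {H : ℂ → ℂ} (hH : MemCeta η H) :
    DifferentiableOn ℂ (spectralWeight H) {μ : ℂ | |μ.re| < 2 * η} :=
  hH.1.mul (by fun_prop)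

lemma MemCeta.exists_norm_spectralWeight_le {η : ℝ} {H : ℂ → ℂ} (hH : MemCeta η H) :
    ∃ C : ℝ, ∀ μ : ℂ, |μ.re| < 2 * η → ‖spectralWeight H μ‖ ≤ C * Real.exp (-|μ.im|) := by
  obtain ⟨C, hC⟩ := hH.2.2
  refine ⟨|C| * (2 * η + 1), fun μ hμ => ?_⟩
  set s := |μ.im| with hs
  have hs0 : 0 ≤ s := abs_nonneg _
  have hη : 0 < 2 * η := (abs_nonneg _).trans_lt hμ
  have hpi : 3 < Real.pi := Real.pi_gt_three
  have hH' : ‖H μ‖ ≤ |C| * Real.exp (-2 * Real.pi * s) :=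
    (hC μ hμ).trans (by gcongr; exact le_abs_self C)
  have hsin : ‖Complex.sin (Real.pi * μ)‖ ≤ Real.exp (Real.pi * s) := by
    simpa [abs_mul, abs_of_pos Real.pi_pos] using norm_sin_le_exp_abs_im (Real.pi * μ)
  have hμs : ‖μ‖ ≤ (2 * η + 1) * Real.exp s := by
    have h1 := norm_le_abs_re_add_abs_im μ
    have h2 := Real.add_one_le_exp s
    nlinarith
  have hw : ‖-(μ * Complex.sin (Real.pi * μ)) / (Real.pi : ℂ)‖ ≤
      ((2 * η + 1) * Real.exp s) * Real.exp (Real.pi * s) := by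
    rw [norm_div, norm_neg, norm_mul, Complex.norm_real, Real.norm_of_nonneg Real.pi_pos.le]
    refine (div_le_self (by positivity) (by linarith)).trans ?_
    gcongr
  calc ‖spectralWeight H μ‖
      ≤ (|C| * Real.exp (-2 * Real.pi * s)) *
          (((2 * η + 1) * Real.exp s) * Real.exp (Real.pi * s)) := by
        rw [spectralWeight, norm_mul]
        gcongr
    _ = |C| * (2 * η + 1) * Real.exp (-2 * Real.pi * s + s + Real.pi * s) := by
        rw [Real.exp_add, Real.exp_add]
        ring
    _ ≤ |C| * (2 * η + 1) * Real.exp (-s) := by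
        gcongr
        nlinarith

lemma integrand_eq (H : ℂ → ℂ) {y : ℝ} (hy : 0 < y) (t : ℝ) :
    H (t * I) * W2 (t * I) y / (Complex.Gamma (t * I) * Complex.Gamma (-(t * I))) =
      (Real.sqrt y : ℂ) * ∫ u : ℝ, spectralWeight H (t * I) *
        Complex.exp (-((2 * Real.pi * y : ℝ) : ℂ) * (Real.cosh u : ℂ)) *
        Complex.exp (t * I * u) := by
  rw [div_eq_mul_inv, inv_Gamma_mul_Gamma_neg, W2, KBessel_mul_I t (by positivity)]
  simp_rw [mul_assoc (spectralWeight H (t * I))]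
  rw [integral_const_mul, spectralWeight]
  ring

lemma integrable_spectralWeight_prod {η : ℝ} (hη : 0 < η) {H : ℂ → ℂ} (hH : MemCeta η H)
    {x : ℝ} (hx : 0 < x) :
    Integrable (Function.uncurry fun t u : ℝ => spectralWeight H (t * I) *
      Complex.exp (-(x : ℂ) * (Real.cosh u : ℂ)) * Complex.exp (t * I * u))
      (volume.prod volume) := by
  obtain ⟨C, hC⟩ := hH.exists_norm_spectralWeight_le
  have hi := integrable_verticalLine hH.differentiableOn_spectralWeight hC (σ := 0)
    (by simpa using hη)
  simp only [ofReal_zero, zero_add] at hi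
  exact (hi.mul_prod (integrable_exp_neg_mul_cosh hx)).mul_bdd (c := 1)
    (g := fun p : ℝ × ℝ => Complex.exp (p.1 * I * p.2))
    (by fun_prop : Continuous _).aestronglyMeasurable
    (Eventually.of_forall fun p => by simp [Complex.norm_exp])

lemma Hflat_eq {η : ℝ} (hη : 0 < η) {H : ℂ → ℂ} (hH : MemCeta η H) {y : ℝ} (hy : 0 < y) :
    Hflat H y = (1 / (4 * (Real.pi : ℂ))) * ((Real.sqrt y : ℂ) * ∫ u : ℝ,
      Complex.exp (-((2 * Real.pi * y : ℝ) : ℂ) * (Real.cosh u : ℂ)) *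
        axisFourier (spectralWeight H) u) := by
  have hx : 0 < 2 * Real.pi * y := by positivity
  rw [Hflat]
  simp_rw [integrand_eq H hy]
  rw [integral_const_mul, integral_integral_swap (integrable_spectralWeight_prod hη hH hx)]
  congr 3
  ext u
  rw [axisFourier, ← integral_const_mul]
  congr 1
  ext t
  ring

lemma sqrt_mul_inv_pow_le {η y : ℝ} {N : ℕ} (hN : η + 1 ≤ N) (hy : 1 ≤ y) :
    Real.sqrt y * (y ^ N)⁻¹ ≤ y⁻¹ ^ η := by
  have hy0 : 0 < y := one_pos.trans_le hy
  rw [Real.sqrt_eq_rpow, ← Real.rpow_natCast, ← Real.rpow_neg hy0.le, ← Real.rpow_add hy0,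
    Real.inv_rpow hy0.le, ← Real.rpow_neg hy0.le]
  exact Real.rpow_le_rpow_of_exponent_le hy (by linarith)

lemma sqrt_mul_pow_le {η y : ℝ} {N : ℕ} (hN : η + 1 ≤ N) (hy0 : 0 < y) (hy : y ≤ 1) :
    Real.sqrt y * y ^ N ≤ y ^ η := by
  rw [Real.sqrt_eq_rpow, ← Real.rpow_natCast, ← Real.rpow_add hy0]
  exact Real.rpow_le_rpow_of_exponent_ge hy0 hy (by linarith)

/-- Kontorovich–Lebedev bound: for `H ∈ C_η` the defining integrand of `H^♭` is
integrable, and `|H^♭(y)| ≤ C min(y, y⁻¹)^η`. -/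
theorem kontorovich_lebedev_bound (η : ℝ) (hη : 40 < η) (H : ℂ → ℂ) (hH : MemCeta η H) :
    (∀ y : ℝ, 0 < y → Integrable (fun t : ℝ =>
      H (t * I) * W2 (t * I) y / (Complex.Gamma (t * I) * Complex.Gamma (-(t * I))))) ∧
    ∃ C : ℝ, 0 < C ∧ ∀ y : ℝ, 0 < y → ‖Hflat H y‖ ≤ C * (min y y⁻¹) ^ η := by
  have hη0 : 0 < η := by linarith
  refine ⟨fun y hy => ?_, ?_⟩
  · simp_rw [integrand_eq H hy]
    exact (integrable_spectralWeight_prod hη0 hH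
      (by positivity : 0 < 2 * Real.pi * y)).integral_prod_left.const_mul _
  obtain ⟨C, hC⟩ := hH.exists_norm_spectralWeight_le
  have hd := hH.differentiableOn_spectralWeight
  obtain ⟨N, hN1, hN2⟩ : ∃ N : ℕ, η + 1 ≤ N ∧ (N : ℝ) < 2 * η :=
    ⟨⌈η + 1⌉₊, Nat.le_ceil _, by
      have := Nat.ceil_lt_add_one (by linarith : 0 ≤ η + 1)
      linarith⟩
  set A := (N + 3) * ∫ u : ℝ, ‖(Real.cosh u : ℂ) ^ N * axisFourier (spectralWeight H) u‖
  set B := N.factorial * ∫ u : ℝ, ‖axisFourier (spectralWeight H) u‖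
  have hA : 0 ≤ A := mul_nonneg (by positivity) (integral_nonneg fun _ => norm_nonneg _)
  have hB : 0 ≤ B := mul_nonneg (by positivity) (integral_nonneg fun _ => norm_nonneg _)
  have hpi : 1 ≤ 2 * Real.pi := by linarith [Real.pi_gt_three]
  refine ⟨A * (2 * Real.pi) ^ N + B + 1, by positivity, fun y hy => ?_⟩
  have hx : 0 < 2 * Real.pi * y := by positivity
  have hnorm : ‖Hflat H y‖ ≤ Real.sqrt y * ‖∫ u : ℝ,
      Complex.exp (-((2 * Real.pi * y : ℝ) : ℂ) * (Real.cosh u : ℂ)) *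
        axisFourier (spectralWeight H) u‖ := by
    rw [Hflat_eq hη0 hH hy, norm_mul, norm_mul, Complex.norm_real,
      Real.norm_of_nonneg (Real.sqrt_nonneg y)]
    refine mul_le_of_le_one_left (by positivity) ?_
    rw [norm_div, norm_one, norm_mul, Complex.norm_real, Real.norm_of_nonneg Real.pi_pos.le,
      Complex.norm_ofNat]
    exact (div_le_one (by positivity)).2 (by linarith)
  rcases le_total y 1 with h | h
  · rw [min_eq_left (h.trans ((one_le_inv₀ hy).2 h))]
    calc ‖Hflat H y‖ ≤ Real.sqrt y * (A * (2 * Real.pi * y) ^ N) := by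
          refine hnorm.trans ?_
          gcongr
          exact norm_integral_exp_neg_cosh_mul_axisFourier_le_pow hd hC (spectralWeight_int H)
            hN2 hx
      _ = A * (2 * Real.pi) ^ N * (Real.sqrt y * y ^ N) := by rw [mul_pow]; ring
      _ ≤ (A * (2 * Real.pi) ^ N + B + 1) * y ^ η := by
          gcongr
          · linarith
          · exact sqrt_mul_pow_le hN1 hy h
  · rw [min_eq_right ((inv_le_one_of_one_le₀ h).trans h)]
    calc ‖Hflat H y‖ ≤ Real.sqrt y * (B * ((2 * Real.pi * y) ^ N)⁻¹) := by
          refine hnorm.trans ?_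
          gcongr
          exact norm_integral_exp_neg_cosh_mul_axisFourier_le_inv_pow hd hC (by linarith) N hx
      _ ≤ Real.sqrt y * (B * (y ^ N)⁻¹) := by
          gcongr
          exact le_mul_of_one_le_left hy.le hpi
      _ = B * (Real.sqrt y * (y ^ N)⁻¹) := by ring
      _ ≤ (A * (2 * Real.pi) ^ N + B + 1) * y⁻¹ ^ η := by
          gcongr
          · have : 0 ≤ A * (2 * Real.pi) ^ N := by positivity
            linarith
          · exact sqrt_mul_inv_pow_le hN1 h
end
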